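/- With L_z : z = 0 the line at infinity: (1) the curves C'₀ ∪ L_z : z f'₀ = 0 and C'_{b'} ∪ L_z : z f'_{b'} = 0 are free with exponents (5,5) and τ(C'_{b'} ∪ L_z) = 75; (2) the curve C'₁ ∪ L_z : z f'₁ = 0 is nearly free with exponents (5,6) and τ(C'₁ ∪ L_z) = 74; (3) the curve C'₀ ∪ C'_{b'} : f'₀ f'_{b'} = 0 is free with exponents (9,10) and τ(C'₀ ∪ C'_{b'}) = 271, and the curve C'₀ ∪ C'_{b'} ∪ L_z : z f'₀ f'_{b'} = 0 is free with exponents (9,11) and τ(C'₀ ∪ C'_{b'} ∪ L_z) = 301. -/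

import Mathlib

open MvPolynomial

noncomputable section

/-- `S = ℂ[x,y,z]`, with `x = X 0`, `y = X 1`, `z = X 2`. -/
abbrev S3 := MvPolynomial (Fin 3) ℂ

/-- The graded `S`-module `D_0(f)` of Jacobian syzygies of `f`. -/
def jacSyz (f : S3) : Submodule S3 (Fin 3 → S3) where
  carrier := {v | v 0 * pderiv 0 f + v 1 * pderiv 1 f + v 2 * pderiv 2 f = 0}
  add_mem' := by
    intro a b ha hb
    simp only [Set.mem_setOf_eq, Pi.add_apply] at *
    linear_combination ha + hb
  zero_mem' := by simp
  smul_mem' := by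
    intro c v hv
    simp only [Set.mem_setOf_eq, Pi.smul_apply, smul_eq_mul] at *
    linear_combination c * hv

/-- `v` is a minimal system of `m` homogeneous generators of `D_0(f)`, the generator
`v j` being a syzygy of degree `dd j`, and `dd` nondecreasing: this says that
`C : f = 0` is an `m`-syzygy curve with exponents `dd`. -/
structure IsMinGenSyz (f : S3) (m : ℕ) (dd : Fin m → ℕ) (v : Fin m → (Fin 3 → S3)) : Prop where
  mem : ∀ j, v j ∈ jacSyz f
  hom : ∀ j i, ((v j) i).IsHomogeneous (dd j)
  ne_zero : ∀ j, v j ≠ 0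
  span_eq : Submodule.span S3 (Set.range v) = jacSyz f
  minimal : ∀ j, v j ∉ Submodule.span S3 (v '' {j' | j' ≠ j})
  mono : Monotone dd

/-- `C : f = 0` is free with exponents `(d1, d2)`. -/
def IsFreeWith (f : S3) (d1 d2 : ℕ) : Prop := ∃ v, IsMinGenSyz f 2 ![d1, d2] v

/-- `C : f = 0` is a free curve (a 2-syzygy curve). -/
def IsFreeCurve (f : S3) : Prop := ∃ d1 d2, IsFreeWith f d1 d2

/-- `C : f = 0` of degree `d` is nearly free with exponents `(d1, d2)`:
a 3-syzygy curve with exponents `(d1, d2, d2)` and `d1 + d2 = d`. -/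
def IsNearlyFreeWith (f : S3) (d d1 d2 : ℕ) : Prop :=
  d1 + d2 = d ∧ ∃ v, IsMinGenSyz f 3 ![d1, d2, d2] v

/-- `C : f = 0` of degree `d` is a nearly free curve. -/
def IsNearlyFree (f : S3) (d : ℕ) : Prop := ∃ d1 d2, IsNearlyFreeWith f d d1 d2

/-- `C : f = 0` of degree `d` is plus-one generated with exponents `(d1, d2, d3)`:
a 3-syzygy curve with `d1 + d2 = d`. -/
def IsPOGWith (f : S3) (d d1 d2 d3 : ℕ) : Prop :=
  d1 + d2 = d ∧ ∃ v, IsMinGenSyz f 3 ![d1, d2, d3] v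

/-- `C : f = 0` of degree `d` is a plus-one generated curve. -/
def IsPOG (f : S3) (d : ℕ) : Prop := ∃ d1 d2 d3, IsPOGWith f d d1 d2 d3

/-- `C : f = 0` of degree `d` is minimal plus-one generated (MPOG),
with exponents `(d1, d2, d2 + 1)`. -/
def IsMPOGWith (f : S3) (d d1 d2 : ℕ) : Prop := IsPOGWith f d d1 d2 (d2 + 1)

/-- `C : f = 0` of degree `d` is an MPOG-curve. -/
def IsMPOG (f : S3) (d : ℕ) : Prop := ∃ d1 d2, IsMPOGWith f d d1 d2

/-- `r = mdr(f)`: the minimal degree of a nonzero (homogeneous) Jacobian relation for `f`. -/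
def IsMDR (f : S3) (r : ℕ) : Prop :=
  (∃ v ∈ jacSyz f, v ≠ 0 ∧ ∀ i, (v i).IsHomogeneous r) ∧
  ∀ m, m < r → ∀ v ∈ jacSyz f, (∀ i, (v i).IsHomogeneous m) → v = 0

/-- The Jacobian ideal `J_f` of `f`. -/
def jacobianIdeal (f : S3) : Ideal S3 := Ideal.span {pderiv 0 f, pderiv 1 f, pderiv 2 f}

/-- The dimension of the degree `k` graded piece of the Milnor algebra `M(f) = S/J_f`. -/
def milnorDim (f : S3) (k : ℕ) : ℕ :=
  Module.finrank ℂ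
    (↥(homogeneousSubmodule (Fin 3) ℂ k) ⧸
      (Submodule.comap (homogeneousSubmodule (Fin 3) ℂ k).subtype
        (Submodule.restrictScalars ℂ (jacobianIdeal f))))

/-- `τ` is the total Tjurina number of the reduced curve `C : f = 0`, i.e. the degree of the
Jacobian ideal `J_f`: for all large `k` one has `dim M(f)_k = τ`. -/
def IsTjurina (f : S3) (τ : ℕ) : Prop := ∀ᶠ k in Filter.atTop, milnorDim f k = τ

/-- `C : f = 0` is a maximal Tjurina curve of type `(d, r)`. -/
def IsMaxTjurina (f : S3) (d r : ℕ) : Prop :=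
  IsMDR f r ∧ d ≤ 2 * r ∧
  ∃ τ : ℕ, IsTjurina f τ ∧
    (τ : ℤ) = ((d : ℤ) - 1) ^ 2 - r * ((d : ℤ) - r - 1) - (Nat.choose (2 * r + 2 - d) 2 : ℤ)

/-- `f` is a product of `d` linear forms all vanishing at a common point, i.e.
`C : f = 0` is the union of `d` lines passing through one point. -/
def IsUnionOfConcurrentLines (f : S3) (d : ℕ) : Prop :=
  ∃ (c : ℂ) (L : Fin d → Fin 3 → ℂ) (v : Fin 3 → ℂ), v ≠ 0 ∧
    f = C c * ∏ j, (∑ i, C (L j i) * X i) ∧ ∀ j, (∑ i, L j i * v i) = 0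

/-- The ideal `I_θ` generated by the 2×2 minors of the matrix with rows `(x,y,z)` and
`(a,b,c)`, defining the eigenscheme `Γ_θ` of the derivation `θ = a ∂_x + b ∂_y + c ∂_z`. -/
def eigenIdeal (a b c : S3) : Ideal S3 :=
  Ideal.span {X 1 * c - X 2 * b, X 2 * a - X 0 * c, X 0 * b - X 1 * a}

/-- The projective plane `ℙ²(ℂ)`. -/
abbrev Pt := Projectivization ℂ (Fin 3 → ℂ)

/-- The eigenscheme `Γ_θ` of `θ = a ∂_x + b ∂_y + c ∂_z` is 0-dimensional:
its set of points in `ℙ²` is finite. -/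
def EigenSchemeFinite (a b c : S3) : Prop :=
  {p : Pt | eval p.rep (X 1 * c - X 2 * b) = 0 ∧ eval p.rep (X 2 * a - X 0 * c) = 0 ∧
      eval p.rep (X 0 * b - X 1 * a) = 0}.Finite

/-- The homogenization `f'₀` of the Briançon-type polynomial `g'`. -/
def f0' : S3 :=
  X 0 ^ 6 * X 1 ^ 4 + 4 * X 0 ^ 5 * X 1 ^ 3 * X 2 ^ 2 + 3 * X 0 ^ 4 * X 1 ^ 3 * X 2 ^ 3 +
    6 * X 0 ^ 4 * X 1 ^ 2 * X 2 ^ 4 + C (65 / 9 : ℂ) * X 0 ^ 3 * X 1 ^ 2 * X 2 ^ 5 +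
    4 * X 0 ^ 3 * X 1 * X 2 ^ 6 + 3 * X 0 ^ 2 * X 1 ^ 2 * X 2 ^ 6 +
    C (49 / 9 : ℂ) * X 0 ^ 2 * X 1 * X 2 ^ 7 + X 0 ^ 2 * X 2 ^ 8 +
    C (10 / 3 : ℂ) * X 0 * X 1 * X 2 ^ 8 + C (11 / 9 : ℂ) * X 0 * X 2 ^ 9 + X 1 * X 2 ^ 9 +
    C (1 / 3 : ℂ) * X 2 ^ 10

/-- `f'_{b'} = f'₀ + (64/81) z¹⁰`. -/
def fb' : S3 := f0' + C (64 / 81 : ℂ) * X 2 ^ 10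

/-- `f'₁ = f'₀ - z¹⁰`. -/
def f1' : S3 := f0' - X 2 ^ 10

/-! ### Cross products of Jacobian syzygies -/

/-- The partial derivatives of `f` have no common prime factor, and `∂f/∂x ≠ 0`. -/
structure HasPrimitiveGradient (f : S3) : Prop where
  ne_zero : pderiv 0 f ≠ 0
  not_dvd : ∀ p : S3, Prime p → p ∣ pderiv 0 f → p ∣ pderiv 1 f → ¬ p ∣ pderiv 2 f

/-- The cross product of `u` and `v` is `h` times the gradient of `f`. -/
structure CrossEq (f h : S3) (u v : Fin 3 → S3) : Prop where
  fst : u 1 * v 2 - u 2 * v 1 = h * pderiv 0 f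
  snd : u 2 * v 0 - u 0 * v 2 = h * pderiv 1 f
  trd : u 0 * v 1 - u 1 * v 0 = h * pderiv 2 f

lemma mem_jacSyz {f : S3} {v : Fin 3 → S3} :
    v ∈ jacSyz f ↔ v 0 * pderiv 0 f + v 1 * pderiv 1 f + v 2 * pderiv 2 f = 0 := Iff.rfl

/-- A triple proportional to a primitive triple is a multiple of it. -/
lemma exists_eq_mul_of_proportional {R : Type*} [CommRing R] [IsDomain R]
    [UniqueFactorizationMonoid R] {p q r a b c : R} (hp : p ≠ 0)
    (hprim : ∀ π : R, Prime π → π ∣ p → π ∣ q → ¬ π ∣ r)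
    (hab : a * q = b * p) (hac : a * r = c * p) :
    ∃ h, a = h * p ∧ b = h * q ∧ c = h * r := by
  classical
  let : GCDMonoid R := UniqueFactorizationMonoid.toGCDMonoid R
  have hunit : IsUnit (gcd p (gcd q r)) := by
    by_contra hnu
    have h0 : gcd p (gcd q r) ≠ 0 := fun h => hp ((gcd_eq_zero_iff _ _).1 h).1
    obtain ⟨π, hπ, hd⟩ := WfDvdMonoid.exists_irreducible_factor hnu h0
    have hd' := hd.trans (gcd_dvd_right _ _)
    exact hprim π hπ.prime (hd.trans (gcd_dvd_left _ _)) (hd'.trans (gcd_dvd_left _ _))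
      (hd'.trans (gcd_dvd_right _ _))
  have hdvd : p ∣ a * gcd p (gcd q r) := by
    have h1 : p ∣ gcd (a * p) (gcd (a * q) (a * r)) :=
      dvd_gcd (dvd_mul_left _ _) (dvd_gcd ⟨b, by rw [hab, mul_comm]⟩ ⟨c, by rw [hac, mul_comm]⟩)
    refine h1.trans (((gcd_mul_left' a p (gcd q r)).symm.trans ?_).symm.dvd)
    exact (Associated.refl _).gcd (gcd_mul_left' a q r).symm
  obtain ⟨h, rfl⟩ := (hunit.dvd_mul_right).1 hdvd
  refine ⟨h, mul_comm _ _, ?_, ?_⟩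
  · exact mul_right_cancel₀ hp (by linear_combination -hab)
  · exact mul_right_cancel₀ hp (by linear_combination -hac)

namespace CrossEq

variable {f h h' : S3} {u v w : Fin 3 → S3}

lemma smul_left (hc : CrossEq f h u v) (a : S3) : CrossEq f (a * h) (a • u) v where
  fst := by simp only [Pi.smul_apply, smul_eq_mul]; linear_combination a * hc.fst
  snd := by simp only [Pi.smul_apply, smul_eq_mul]; linear_combination a * hc.snd
  trd := by simp only [Pi.smul_apply, smul_eq_mul]; linear_combination a * hc.trd

lemma add_left (hu : CrossEq f h u v) (hw : CrossEq f h' w v) : CrossEq f (h + h') (u + w) v where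
  fst := by simp only [Pi.add_apply]; linear_combination hu.fst + hw.fst
  snd := by simp only [Pi.add_apply]; linear_combination hu.snd + hw.snd
  trd := by simp only [Pi.add_apply]; linear_combination hu.trd + hw.trd

lemma swap (hc : CrossEq f h u v) : CrossEq f (-h) v u where
  fst := by linear_combination -hc.fst
  snd := by linear_combination -hc.snd
  trd := by linear_combination -hc.trd

lemma self (u : Fin 3 → S3) : CrossEq f 0 u u where
  fst := by ring
  snd := by ring
  trd := by ring

lemma zero_left (v : Fin 3 → S3) : CrossEq f 0 0 v where
  fst := by simp
  snd := by simp
  trd := by simp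

lemma unique (hf : pderiv 0 f ≠ 0) (hc : CrossEq f h u v) (hc' : CrossEq f h' u v) : h = h' :=
  mul_right_cancel₀ hf (hc.fst.symm.trans hc'.fst)

lemma mem_left (h0 : h ≠ 0) (hc : CrossEq f h u v) : u ∈ jacSyz f :=
  mem_jacSyz.2 <| mul_left_cancel₀ h0 <| by
    linear_combination -u 0 * hc.fst - u 1 * hc.snd - u 2 * hc.trd

lemma mem_right (h0 : h ≠ 0) (hc : CrossEq f h u v) : v ∈ jacSyz f :=
  hc.swap.mem_left (neg_ne_zero.2 h0)

lemma ne_zero_left (hf : pderiv 0 f ≠ 0) (h0 : h ≠ 0) (hc : CrossEq f h u v) : u ≠ 0 := by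
  rintro rfl
  exact h0 (hc.unique hf (zero_left v))

lemma ne_zero_right (hf : pderiv 0 f ≠ 0) (h0 : h ≠ 0) (hc : CrossEq f h u v) : v ≠ 0 :=
  hc.swap.ne_zero_left hf (neg_ne_zero.2 h0)

/-- A vector parallel to two independent vectors vanishes. -/
lemma eq_zero (hf : pderiv 0 f ≠ 0) (h0 : h ≠ 0) (hc : CrossEq f h u v)
    (hu : CrossEq f 0 w u) (hv : CrossEq f 0 w v) : w = 0 := by
  have hne : h * pderiv 0 f ≠ 0 := mul_ne_zero h0 hf
  have h1 : w 1 = 0 := mul_left_cancel₀ hne <| by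
    linear_combination -w 1 * hc.fst + u 1 * hv.fst - v 1 * hu.fst
  have h2 : w 2 = 0 := mul_left_cancel₀ hne <| by
    linear_combination -w 2 * hc.fst + u 2 * hv.fst - v 2 * hu.fst
  have h3 : w 0 = 0 := mul_left_cancel₀ hne <| by
    linear_combination -w 0 * hc.fst + v 2 * hu.trd + v 1 * hu.snd + u 0 * v 2 * h1
      - u 0 * v 1 * h2
  funext i
  fin_cases i <;> assumption

end CrossEq

lemma HasPrimitiveGradient.exists_crossEq {f : S3} (hf : HasPrimitiveGradient f)
    {u v : Fin 3 → S3} (hu : u ∈ jacSyz f) (hv : v ∈ jacSyz f) : ∃ h, CrossEq f h u v := by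
  rw [mem_jacSyz] at hu hv
  obtain ⟨h, h1, h2, h3⟩ := exists_eq_mul_of_proportional (a := u 1 * v 2 - u 2 * v 1)
    (b := u 2 * v 0 - u 0 * v 2) (c := u 0 * v 1 - u 1 * v 0) hf.ne_zero hf.not_dvd
    (by linear_combination v 2 * hu - u 2 * hv) (by linear_combination u 1 * hv - v 1 * hu)
  exact ⟨h, h1, h2, h3⟩

/-- Saito's criterion. -/
lemma HasPrimitiveGradient.exists_eq_add {f h : S3} (hf : HasPrimitiveGradient f) (hh : IsUnit h)
    {u v w : Fin 3 → S3} (hc : CrossEq f h u v) (hw : w ∈ jacSyz f) :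
    ∃ a b : S3, w = a • u + b • v := by
  obtain ⟨a, ha⟩ := hf.exists_crossEq hw (hc.mem_right hh.ne_zero)
  obtain ⟨b, hb⟩ := hf.exists_crossEq hw (hc.mem_left hh.ne_zero)
  obtain ⟨k, hk⟩ := hh.exists_right_inv
  refine ⟨k * a, -(k * b), ?_⟩
  rw [← sub_eq_zero]
  refine hc.eq_zero hf.ne_zero hh.ne_zero (w := w - ((k * a) • u + (-(k * b)) • v)) ?_ ?_
  · have := hb.add_left (((CrossEq.self u).smul_left (-(k * a))).add_left
      (hc.swap.smul_left (k * b)))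
    convert this using 1
    · linear_combination b * hk
    · module
  · have := ha.add_left ((hc.smul_left (-(k * a))).add_left
      ((CrossEq.self v).smul_left (k * b)))
    convert this using 1
    · linear_combination a * hk
    · module

lemma CrossEq.linearIndependent {f h : S3} (hf : pderiv 0 f ≠ 0) (h0 : h ≠ 0)
    {u v : Fin 3 → S3} (hc : CrossEq f h u v) : LinearIndependent S3 ![u, v] := by
  rw [LinearIndependent.pair_iff]
  intro a b hab
  have h1 := (hc.smul_left a).add_left ((CrossEq.self v).smul_left b)
  have h2 := ((CrossEq.self u).smul_left a).add_left (hc.swap.smul_left b)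
  rw [hab] at h1 h2
  have e1 := h1.unique hf (CrossEq.zero_left v)
  have e2 := h2.unique hf (CrossEq.zero_left u)
  constructor
  · simpa [h0] using e1
  · simpa [h0] using e2

lemma HasPrimitiveGradient.isMinGenSyz_pair {f h : S3} (hf : HasPrimitiveGradient f)
    (hh : IsUnit h) {d₁ d₂ : ℕ} (hd : d₁ ≤ d₂) {u v : Fin 3 → S3} (hc : CrossEq f h u v)
    (hu : ∀ i, (u i).IsHomogeneous d₁) (hv : ∀ i, (v i).IsHomogeneous d₂) :
    IsMinGenSyz f 2 ![d₁, d₂] ![u, v] where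
  mem j := by
    fin_cases j
    exacts [hc.mem_left hh.ne_zero, hc.mem_right hh.ne_zero]
  hom j := by
    fin_cases j
    exacts [hu, hv]
  ne_zero j := by
    fin_cases j
    exacts [hc.ne_zero_left hf.ne_zero hh.ne_zero, hc.ne_zero_right hf.ne_zero hh.ne_zero]
  span_eq := by
    refine le_antisymm (Submodule.span_le.2 ?_) fun w hw => ?_
    · rintro _ ⟨j, rfl⟩
      fin_cases j
      exacts [hc.mem_left hh.ne_zero, hc.mem_right hh.ne_zero]
    · obtain ⟨a, b, rfl⟩ := hf.exists_eq_add hh hc hw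
      rw [Matrix.range_cons_cons_empty]
      exact Submodule.mem_span_pair.2 ⟨a, b, rfl⟩
  minimal j := (hc.linearIndependent hf.ne_zero hh.ne_zero).notMem_span_image (by simp)
  mono := by
    intro i j hij
    fin_cases i <;> fin_cases j <;> simp_all

/-- The relations among three syzygies whose pairwise cross products are given by
`q`, `l`, `m` with `l`, `m` coprime are the multiples of `(q, l, m)`. -/
lemma CrossEq.exists_relation {f q l m : S3} (hf : pderiv 0 f ≠ 0) (hm : m ≠ 0)
    (hlm : ∀ a b : S3, a * m = b * l → ∃ t, a = t * l ∧ b = t * m) {u v w : Fin 3 → S3}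
    (hvw : CrossEq f q v w) (hwu : CrossEq f l w u) (huv : CrossEq f m u v) {a b c : S3}
    (h : a • u + b • v + c • w = 0) : ∃ t, a = t * q ∧ b = t * l ∧ c = t * m := by
  have h1 := ((CrossEq.self u).smul_left a |>.add_left (huv.swap.smul_left b)).add_left
    (hwu.smul_left c)
  have h2 := ((huv.smul_left a).add_left ((CrossEq.self v).smul_left b)).add_left
    (hvw.swap.smul_left c)
  rw [h] at h1 h2
  have e1 := h1.unique hf (CrossEq.zero_left u)
  have e2 := h2.unique hf (CrossEq.zero_left v)
  obtain ⟨t, rfl, rfl⟩ := hlm b c (by linear_combination -e1)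
  exact ⟨t, mul_right_cancel₀ hm (by linear_combination e2), rfl, rfl⟩

lemma CrossEq.relation {f q l m : S3} (hf : pderiv 0 f ≠ 0) (hm : m ≠ 0) {u v w : Fin 3 → S3}
    (hvw : CrossEq f q v w) (hwu : CrossEq f l w u) (huv : CrossEq f m u v) :
    q • u + l • v + m • w = 0 := by
  refine huv.eq_zero hf hm ?_ ?_
  · convert ((CrossEq.self u).smul_left q |>.add_left (huv.swap.smul_left l)).add_left
      (hwu.smul_left m) using 1
    ring
  · convert ((huv.smul_left q).add_left ((CrossEq.self v).smul_left l)).add_left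
      (hvw.swap.smul_left m) using 1
    ring

lemma HasPrimitiveGradient.exists_eq_add_add {f q l m : S3} (hf : HasPrimitiveGradient f)
    (hl : l ≠ 0) (hm : m ≠ 0)
    (hlm : ∀ a b : S3, a * m = b * l → ∃ t, a = t * l ∧ b = t * m)
    (hq : ∀ a b c : S3, a * q = b * l + c * m → ∃ s t, a = s * l + t * m)
    {u v w y : Fin 3 → S3}
    (hvw : CrossEq f q v w) (hwu : CrossEq f l w u) (huv : CrossEq f m u v)
    (hy : y ∈ jacSyz f) : ∃ a b c : S3, y = a • u + b • v + c • w := by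
  obtain ⟨α, hα⟩ := hf.exists_crossEq hy (huv.mem_left hm)
  obtain ⟨β, hβ⟩ := hf.exists_crossEq hy (huv.mem_right hm)
  obtain ⟨γ, hγ⟩ := hf.exists_crossEq hy (hwu.mem_left hl)
  have hrel := CrossEq.relation hf.ne_zero hm hvw hwu huv
  have key : q * α + l * β + m * γ = 0 := by
    have := ((hα.swap.smul_left q).add_left (hβ.swap.smul_left l)).add_left (hγ.swap.smul_left m)
    rw [hrel] at this
    linear_combination -this.unique hf.ne_zero (CrossEq.zero_left y)
  obtain ⟨s, t, rfl⟩ := hq α (-β) (-γ) (by linear_combination key)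
  obtain ⟨r, hr₁, hr₂⟩ := hlm (-(γ + t * q)) (β + s * q) (by linear_combination -key)
  refine ⟨r, -t, s, ?_⟩
  rw [← sub_eq_zero]
  refine huv.eq_zero hf.ne_zero hm (w := y - (r • u + (-t) • v + s • w)) ?_ ?_
  · convert hα.add_left (((CrossEq.self u).smul_left (-r)).add_left
      ((huv.swap.smul_left t).add_left (hwu.smul_left (-s)))) using 1
    · ring
    · module
  · convert hβ.add_left ((huv.smul_left (-r)).add_left
      (((CrossEq.self v).smul_left t).add_left (hvw.swap.smul_left (-s)))) using 1
    · linear_combination -hr₂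
    · module

lemma HasPrimitiveGradient.isMinGenSyz_triple {f q l m : S3} (hf : HasPrimitiveGradient f)
    (hl : l ≠ 0) (hm : m ≠ 0) (hq₀ : q ≠ 0)
    (hlm : ∀ a b : S3, a * m = b * l → ∃ t, a = t * l ∧ b = t * m)
    (hq : ∀ a b c : S3, a * q = b * l + c * m → ∃ s t, a = s * l + t * m)
    (hqu : ¬ IsUnit q) (hlu : ¬ IsUnit l) (hmu : ¬ IsUnit m)
    {d₁ d₂ : ℕ} (hd : d₁ ≤ d₂) {u v w : Fin 3 → S3}
    (hvw : CrossEq f q v w) (hwu : CrossEq f l w u) (huv : CrossEq f m u v)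
    (hu : ∀ i, (u i).IsHomogeneous d₁) (hv : ∀ i, (v i).IsHomogeneous d₂)
    (hw : ∀ i, (w i).IsHomogeneous d₂) :
    IsMinGenSyz f 3 ![d₁, d₂, d₂] ![u, v, w] where
  mem j := by
    fin_cases j
    exacts [huv.mem_left hm, huv.mem_right hm, hvw.mem_right hq₀]
  hom j := by
    fin_cases j
    exacts [hu, hv, hw]
  ne_zero j := by
    fin_cases j
    exacts [huv.ne_zero_left hf.ne_zero hm, huv.ne_zero_right hf.ne_zero hm,
      hvw.ne_zero_right hf.ne_zero hq₀]
  span_eq := by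
    refine le_antisymm (Submodule.span_le.2 ?_) fun y hy => ?_
    · rintro _ ⟨j, rfl⟩
      fin_cases j
      exacts [huv.mem_left hm, huv.mem_right hm, hvw.mem_right hq₀]
    · obtain ⟨a, b, c, rfl⟩ := hf.exists_eq_add_add hl hm hlm hq hvw hwu huv hy
      rw [Submodule.mem_span_range_iff_exists_fun]
      exact ⟨![a, b, c], by simp [Fin.sum_univ_three]⟩
  minimal j hj := by
    have hcompl : {j' : Fin 3 | j' ≠ j} = {j + 1, j + 2} := by
      ext i
      fin_cases i <;> fin_cases j <;> decide
    rw [hcompl, Set.image_pair, Submodule.mem_span_pair] at hj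
    obtain ⟨a, b, hab⟩ := hj
    fin_cases j
    · obtain ⟨t, h1, -⟩ := CrossEq.exists_relation hf.ne_zero hm hlm hvw hwu huv
        (a := -1) (b := a) (c := b) (by rw [add_assoc]; exact (congrArg _ hab).trans (by simp))
      exact hqu (.of_mul_eq_one (-t) (by linear_combination h1))
    · obtain ⟨t, -, h1, -⟩ := CrossEq.exists_relation hf.ne_zero hm hlm hvw hwu huv
        (a := b) (b := -1) (c := a)
        (by rw [add_right_comm, add_comm (b • u)]; exact (congrArg (· + _) hab).trans (by simp))
      exact hlu (.of_mul_eq_one (-t) (by linear_combination h1))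
    · obtain ⟨t, -, -, h1⟩ := CrossEq.exists_relation hf.ne_zero hm hlm hvw hwu huv
        (a := a) (b := b) (c := -1) ((congrArg (· + _) hab).trans (by simp))
      exact hmu (.of_mul_eq_one (-t) (by linear_combination h1))
  mono := by
    intro i j hij
    fin_cases i <;> fin_cases j <;> simp_all

/-! ### Hilbert functions -/

instance finite_homogeneousSubmodule (n : ℕ) :
    Module.Finite ℂ (homogeneousSubmodule (Fin 3) ℂ n) :=
  Module.Finite.iff_fg.2 (homogeneousSubmodule_fg (Fin 3) ℂ n)

/-- The dimension of the space of ternary forms of degree `n`. -/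
def formDim (n : ℕ) : ℕ := Module.finrank ℂ (homogeneousSubmodule (Fin 3) ℂ n)

lemma two_mul_formDim (n : ℕ) : 2 * formDim n = (n + 1) * (n + 2) := by
  have hset : {d : Fin 3 →₀ ℕ | d.degree = n} =
      ((Finset.univ : Finset (Fin 3)).finsuppAntidiag n : Set (Fin 3 →₀ ℕ)) := by
    ext d
    simp [Finsupp.degree_eq_sum]
  have hrank : formDim n = (n + 2).choose 2 := by
    rw [formDim, homogeneousSubmodule_eq_finsupp_supported, hset]
    change Module.finrank ℂ (restrictSupport ℂ _) = _
    rw [Module.finrank_eq_nat_card_basis (basisRestrictSupport ℂ _), Nat.card_coe_set_eq,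
      Set.ncard_coe_finset, Finset.card_finsuppAntidiag_nat_eq_choose, Finset.card_univ,
      Fintype.card_fin, show 3 + n - 1 = n + 2 by omega, Nat.choose_symm_add]
  rw [hrank, Nat.choose_two_right, Nat.mul_div_cancel' (Nat.even_mul_pred_self _).two_dvd]
  simp [mul_comm]

lemma homogeneousComponent_mul_of_isHomogeneous {a b : S3} {d n : ℕ} (hb : b.IsHomogeneous d)
    (hd : d ≤ n) : homogeneousComponent n (a * b) = homogeneousComponent (n - d) a * b := by
  let := gradedAlgebra (σ := Fin 3) (R := ℂ)
  have := DirectSum.coe_decompose_mul_of_right_mem_of_le (homogeneousSubmodule (Fin 3) ℂ)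
    (a := a) (b := b) (i := d) (n := n) hb hd
  rw [← decomposition.decompose'_apply, ← decomposition.decompose'_apply]
  exact this

/-- The degree `k` piece of the Jacobian ideal. -/
def jacobianPiece (f : S3) (k : ℕ) : Submodule ℂ (homogeneousSubmodule (Fin 3) ℂ k) :=
  Submodule.comap (homogeneousSubmodule (Fin 3) ℂ k).subtype
    (Submodule.restrictScalars ℂ (jacobianIdeal f))

lemma milnorDim_add_finrank_jacobianPiece (f : S3) (k : ℕ) :
    milnorDim f k + Module.finrank ℂ (jacobianPiece f k) = formDim k :=
  Submodule.finrank_quotient_add_finrank (jacobianPiece f k)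

/-- The map `(a₀, a₁, a₂) ↦ ∑ aᵢ ∂f/∂xᵢ` on triples of forms of degree `n`. -/
def gradientPairing (f : S3) (n : ℕ) : (Fin 3 → homogeneousSubmodule (Fin 3) ℂ n) →ₗ[ℂ] S3 where
  toFun a := ∑ i, (a i : S3) * pderiv i f
  map_add' a b := by simp [add_mul, Finset.sum_add_distrib]
  map_smul' c a := by simp [Finset.smul_sum]

lemma gradientPairing_apply (f : S3) (n : ℕ) (a : Fin 3 → homogeneousSubmodule (Fin 3) ℂ n) :
    gradientPairing f n a = ∑ i, (a i : S3) * pderiv i f := rfl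

/-- The map `a ↦ ∑ aⱼ vⱼ` on families of forms `aⱼ` of degree `n - dⱼ`. -/
def gradedCombination {m : ℕ} (dd : Fin m → ℕ) (v : Fin m → (Fin 3 → S3)) (n : ℕ) :
    ((j : Fin m) → homogeneousSubmodule (Fin 3) ℂ (n - dd j)) →ₗ[ℂ] (Fin 3 → S3) where
  toFun a := ∑ j, (a j : S3) • v j
  map_add' a b := by simp [add_smul, Finset.sum_add_distrib]
  map_smul' c a := by simp [Finset.smul_sum]

lemma gradedCombination_apply {m : ℕ} (dd : Fin m → ℕ) (v : Fin m → (Fin 3 → S3)) (n : ℕ)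
    (a : (j : Fin m) → homogeneousSubmodule (Fin 3) ℂ (n - dd j)) :
    gradedCombination dd v n a = ∑ j, (a j : S3) • v j := rfl

/-- The inclusion of triples of forms of degree `n` into all triples of polynomials. -/
def tripleInclusion (n : ℕ) :
    (Fin 3 → homogeneousSubmodule (Fin 3) ℂ n) →ₗ[ℂ] (Fin 3 → S3) where
  toFun a i := a i
  map_add' _ _ := rfl
  map_smul' _ _ := rfl

lemma tripleInclusion_apply (n : ℕ) (a : Fin 3 → homogeneousSubmodule (Fin 3) ℂ n) (i : Fin 3) :
    tripleInclusion n a i = a i := rfl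

lemma tripleInclusion_injective (n : ℕ) : Function.Injective (tripleInclusion n) :=
  fun _ _ h => funext fun i => Subtype.ext (congrFun h i)

lemma mem_jacobianIdeal {f p : S3} :
    p ∈ jacobianIdeal f ↔ ∃ a : Fin 3 → S3, ∑ i, a i * pderiv i f = p := by
  have : ({pderiv 0 f, pderiv 1 f, pderiv 2 f} : Set S3) = Set.range fun i => pderiv i f := by
    ext g
    simp [Fin.exists_fin_succ, eq_comm]
  rw [jacobianIdeal, this, Ideal.mem_span_range_iff_exists_fun]

lemma map_jacobianPiece {f : S3} {e : ℕ} (he : ∀ i, (pderiv i f).IsHomogeneous e) (n : ℕ) :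
    (jacobianPiece f (n + e)).map (homogeneousSubmodule (Fin 3) ℂ (n + e)).subtype =
      LinearMap.range (gradientPairing f n) := by
  rw [jacobianPiece, Submodule.map_comap_subtype]
  ext p
  simp only [Submodule.mem_inf, Submodule.restrictScalars_mem, mem_jacobianIdeal,
    LinearMap.mem_range, gradientPairing_apply]
  constructor
  · rintro ⟨hp, a, rfl⟩
    refine ⟨fun i => ⟨homogeneousComponent n (a i), homogeneousComponent_mem _ _⟩, ?_⟩
    conv_rhs => rw [← homogeneousComponent_eq_self hp, map_sum]
    refine Finset.sum_congr rfl fun i _ => ?_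
    rw [homogeneousComponent_mul_of_isHomogeneous (he i) (Nat.le_add_left e n),
      Nat.add_sub_cancel]
  · rintro ⟨a, rfl⟩
    exact ⟨IsHomogeneous.sum _ _ _ fun i _ => (a i).2.mul (he i), fun i => a i, rfl⟩

lemma IsMinGenSyz.map_ker_eq_range {f : S3} {m : ℕ} {dd : Fin m → ℕ} {v : Fin m → (Fin 3 → S3)}
    (h : IsMinGenSyz f m dd v) {n : ℕ} (hn : ∀ j, dd j ≤ n) :
    (LinearMap.ker (gradientPairing f n)).map (tripleInclusion n) =
      LinearMap.range (gradedCombination dd v n) := by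
  ext w
  constructor
  · rintro ⟨a, ha, rfl⟩
    have hmem : tripleInclusion n a ∈ Submodule.span S3 (Set.range v) := by
      rw [SetLike.mem_coe, LinearMap.mem_ker, gradientPairing_apply, Fin.sum_univ_three] at ha
      rw [h.span_eq, mem_jacSyz]
      exact ha
    obtain ⟨c, hc⟩ := (Submodule.mem_span_range_iff_exists_fun S3).1 hmem
    refine ⟨fun j => ⟨homogeneousComponent (n - dd j) (c j), homogeneousComponent_mem _ _⟩, ?_⟩
    funext i
    have hi := congrArg (homogeneousComponent n) (congrFun hc i)
    rw [tripleInclusion_apply, homogeneousComponent_eq_self (a i).2, Finset.sum_apply,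
      map_sum] at hi
    rw [gradedCombination_apply, Finset.sum_apply, tripleInclusion_apply, ← hi]
    refine Finset.sum_congr rfl fun j _ => ?_
    simp only [Pi.smul_apply, smul_eq_mul]
    exact (homogeneousComponent_mul_of_isHomogeneous (h.hom j i) (hn j)).symm
  · rintro ⟨a, rfl⟩
    have hhom (i : Fin 3) : (gradedCombination dd v n a i).IsHomogeneous n := by
      rw [gradedCombination_apply, Finset.sum_apply]
      refine IsHomogeneous.sum _ _ _ fun j _ => ?_
      have := (a j).2.mul (h.hom j i)
      rwa [Nat.sub_add_cancel (hn j)] at this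
    have hmem : gradedCombination dd v n a ∈ jacSyz f := by
      rw [gradedCombination_apply]
      exact Submodule.sum_mem _ fun j _ => Submodule.smul_mem _ _ (h.mem j)
    refine ⟨fun i => ⟨_, hhom i⟩, ?_, rfl⟩
    rw [SetLike.mem_coe, LinearMap.mem_ker, gradientPairing_apply, Fin.sum_univ_three]
    exact mem_jacSyz.1 hmem

lemma IsMinGenSyz.milnorDim_add {f : S3} {e : ℕ} (he : ∀ i, (pderiv i f).IsHomogeneous e)
    {m : ℕ} {dd : Fin m → ℕ} {v : Fin m → (Fin 3 → S3)} (h : IsMinGenSyz f m dd v)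
    {n : ℕ} (hn : ∀ j, dd j ≤ n) :
    milnorDim f (n + e) + 3 * formDim n +
        Module.finrank ℂ (LinearMap.ker (gradedCombination dd v n)) =
      formDim (n + e) + ∑ j, formDim (n - dd j) := by
  have h1 := milnorDim_add_finrank_jacobianPiece f (n + e)
  have h2 := (gradientPairing f n).finrank_range_add_finrank_ker
  have h3 := (gradedCombination dd v n).finrank_range_add_finrank_ker
  have h4 : Module.finrank ℂ (LinearMap.range (gradientPairing f n)) =
      Module.finrank ℂ (jacobianPiece f (n + e)) := by
    rw [← map_jacobianPiece he]
    exact (Submodule.equivMapOfInjective _ (Submodule.subtype_injective _) _).symm.finrank_eq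
  have h5 : Module.finrank ℂ (LinearMap.range (gradedCombination dd v n)) =
      Module.finrank ℂ (LinearMap.ker (gradientPairing f n)) := by
    rw [← h.map_ker_eq_range hn]
    exact (Submodule.equivMapOfInjective _ (tripleInclusion_injective n) _).symm.finrank_eq
  rw [Module.finrank_pi_fintype] at h2 h3
  simp only [Finset.sum_const, Finset.card_univ, Fintype.card_fin, smul_eq_mul] at h2 h3
  simp only [formDim] at h1 ⊢
  omega

/-- The total Tjurina number of a free curve. -/
lemma IsMinGenSyz.isTjurina_pair {f : S3} {d₁ d₂ τ : ℕ} {u v : Fin 3 → S3}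
    (hf : f.IsHomogeneous (d₁ + d₂ + 1)) (h : IsMinGenSyz f 2 ![d₁, d₂] ![u, v])
    (hind : LinearIndependent S3 ![u, v]) (hτ : τ + d₁ * d₂ = (d₁ + d₂) ^ 2) :
    IsTjurina f τ := by
  refine Filter.eventually_atTop.2 ⟨d₁ + d₂ + (d₁ + d₂), fun k hk => ?_⟩
  obtain ⟨r, rfl⟩ := Nat.exists_eq_add_of_le hk
  have he (i : Fin 3) : (pderiv i f).IsHomogeneous (d₁ + d₂) := by simpa using hf.pderiv (i := i)
  have hker : LinearMap.ker (gradedCombination ![d₁, d₂] ![u, v] (d₁ + d₂ + r)) = ⊥ := by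
    rw [LinearMap.ker_eq_bot']
    intro a ha
    funext j
    exact Subtype.ext (Fintype.linearIndependent_iff.1 hind (fun j => (a j : S3)) ha j)
  have key := h.milnorDim_add he (n := d₁ + d₂ + r) (by simp [Fin.forall_fin_two]; omega)
  rw [hker, finrank_bot, Fin.sum_univ_two] at key
  simp only [Matrix.cons_val_zero, Matrix.cons_val_one] at key
  rw [show d₁ + d₂ + r - d₁ = d₂ + r by omega, show d₁ + d₂ + r - d₂ = d₁ + r by omega] at key
  rw [show d₁ + d₂ + (d₁ + d₂) + r = d₁ + d₂ + r + (d₁ + d₂) by omega]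
  have e1 := two_mul_formDim (d₁ + d₂ + r)
  have e2 := two_mul_formDim (d₁ + d₂ + r + (d₁ + d₂))
  have e3 := two_mul_formDim (d₂ + r)
  have e4 := two_mul_formDim (d₁ + r)
  nlinarith

/-- The total Tjurina number of a nearly free curve. -/
lemma IsMinGenSyz.isTjurina_triple {f q l m : S3} {d₁ s τ : ℕ} {u v w : Fin 3 → S3}
    (hf : f.IsHomogeneous (d₁ + (d₁ + s) + 1))
    (h : IsMinGenSyz f 3 ![d₁, d₁ + s + 1, d₁ + s + 1] ![u, v, w])
    (hq : q.IsHomogeneous (s + 2)) (hl : l.IsHomogeneous 1) (hm : m.IsHomogeneous 1)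
    (hm₀ : m ≠ 0) (hrel : q • u + l • v + m • w = 0)
    (hgen : ∀ a b c : S3, a • u + b • v + c • w = 0 → ∃ t, a = t * q ∧ b = t * l ∧ c = t * m)
    (hτ : τ + d₁ * (d₁ + s) + 1 = (d₁ + (d₁ + s)) ^ 2) :
    IsTjurina f τ := by
  refine Filter.eventually_atTop.2 ⟨(d₁ + s + 2) + (d₁ + (d₁ + s)), fun k hk => ?_⟩
  obtain ⟨r, rfl⟩ := Nat.exists_eq_add_of_le hk
  rw [add_right_comm]
  have he (i : Fin 3) : (pderiv i f).IsHomogeneous (d₁ + (d₁ + s)) := by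
    simpa using hf.pderiv (i := i)
  have key := h.milnorDim_add he (n := d₁ + s + 2 + r)
    (by simp [Fin.forall_fin_succ]; omega)
  have hker : Module.finrank ℂ (LinearMap.ker (gradedCombination
      ![d₁, d₁ + s + 1, d₁ + s + 1] ![u, v, w] (d₁ + s + 2 + r))) = formDim r := by
    have hdeg₀ : r + (s + 2) = d₁ + s + 2 + r - d₁ := by omega
    have hdeg₁ : r + 1 = d₁ + s + 2 + r - (d₁ + s + 1) := by omega
    have hmem (t : S3) (ht : t.IsHomogeneous r) (j : Fin 3) :
        (![t * q, t * l, t * m] j).IsHomogeneous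
          (d₁ + s + 2 + r - ![d₁, d₁ + s + 1, d₁ + s + 1] j) := by
      fin_cases j
      · exact hdeg₀ ▸ ht.mul hq
      · exact hdeg₁ ▸ ht.mul hl
      · exact hdeg₁ ▸ ht.mul hm
    let χ : homogeneousSubmodule (Fin 3) ℂ r →ₗ[ℂ] ((j : Fin 3) →
        homogeneousSubmodule (Fin 3) ℂ
          (d₁ + s + 2 + r - ![d₁, d₁ + s + 1, d₁ + s + 1] j)) :=
      { toFun t j := ⟨![t * q, t * l, t * m] j, hmem t t.2 j⟩
        map_add' a b := by
          funext j
          apply Subtype.ext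
          fin_cases j <;> exact add_mul _ _ _
        map_smul' c a := by
          funext j
          apply Subtype.ext
          fin_cases j <;> exact smul_mul_assoc _ _ _ }
    have hχ : Function.Injective χ := by
      intro a b hab
      apply Subtype.ext
      exact mul_right_cancel₀ hm₀ (congrArg Subtype.val (congrFun hab 2))
    have hrange : LinearMap.range χ = LinearMap.ker (gradedCombination
        ![d₁, d₁ + s + 1, d₁ + s + 1] ![u, v, w] (d₁ + s + 2 + r)) := by
      ext a
      rw [LinearMap.mem_ker, gradedCombination_apply, Fin.sum_univ_three]
      constructor
      · rintro ⟨t, rfl⟩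
        change ((t : S3) * q) • u + ((t : S3) * l) • v + ((t : S3) * m) • w = 0
        rw [mul_smul, mul_smul, mul_smul, ← smul_add, ← smul_add, hrel, smul_zero]
      · intro ha
        obtain ⟨t, h0, h1, h2⟩ := hgen _ _ _ ha
        have hcomp : homogeneousComponent r t * m = t * m := by
          have h2' : (t * m).IsHomogeneous (r + 1) := by
            rw [← h2, hdeg₁]
            exact (a 2).2
          rw [← homogeneousComponent_eq_self h2',
            homogeneousComponent_mul_of_isHomogeneous hm (Nat.le_add_left 1 r), Nat.add_sub_cancel]
        have ht : homogeneousComponent r t = t := mul_right_cancel₀ hm₀ hcomp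
        refine ⟨⟨t, ht ▸ homogeneousComponent_isHomogeneous r t⟩, ?_⟩
        funext j
        apply Subtype.ext
        fin_cases j
        exacts [h0.symm, h1.symm, h2.symm]
    rw [← hrange, LinearMap.finrank_range_of_inj hχ, formDim]
  rw [hker, Fin.sum_univ_three] at key
  simp only [Matrix.cons_val_zero, Matrix.cons_val_one, Matrix.cons_val] at key
  rw [show d₁ + s + 2 + r - d₁ = s + 2 + r by omega,
    show d₁ + s + 2 + r - (d₁ + s + 1) = r + 1 by omega] at key
  have e1 := two_mul_formDim (d₁ + s + 2 + r)
  have e2 := two_mul_formDim (d₁ + s + 2 + r + (d₁ + (d₁ + s)))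
  have e3 := two_mul_formDim (s + 2 + r)
  have e4 := two_mul_formDim (r + 1)
  have e5 := two_mul_formDim r
  nlinarith

/-! ### Explicit ternary forms -/

/-- The polynomial with integer coefficients whose terms `c xⁱ yʲ zᵏ` are listed as
`(c, i, j, k)`. -/
def ternaryForm (l : List (ℤ × ℕ × ℕ × ℕ)) : S3 :=
  (l.map fun t => (t.1 : S3) * X 0 ^ t.2.1 * X 1 ^ t.2.2.1 * X 2 ^ t.2.2.2).sum

lemma isHomogeneous_ternaryForm {l : List (ℤ × ℕ × ℕ × ℕ)} {n : ℕ}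
    (h : ∀ t ∈ l, t.2.1 + t.2.2.1 + t.2.2.2 = n) : (ternaryForm l).IsHomogeneous n := by
  induction l with
  | nil => simpa [ternaryForm] using isHomogeneous_zero (Fin 3) ℂ n
  | cons t l ih =>
    rw [ternaryForm, List.map_cons, List.sum_cons]
    refine .add ?_ (ih fun s hs => h s (by simp [hs]))
    have ht := (((isHomogeneous_C (Fin 3) (t.1 : ℂ)).mul (isHomogeneous_X_pow 0 t.2.1)).mul
      (isHomogeneous_X_pow 1 t.2.2.1)).mul (isHomogeneous_X_pow 2 t.2.2.2)
    rwa [zero_add, h t (by simp), map_intCast] at ht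

lemma pderiv_zero_ternaryForm (l : List (ℤ × ℕ × ℕ × ℕ)) : pderiv 0 (ternaryForm l) =
    ternaryForm (l.map fun t => (t.1 * t.2.1, t.2.1 - 1, t.2.2.1, t.2.2.2)) := by
  induction l with
  | nil => simp [ternaryForm]
  | cons t l ih =>
    simp only [ternaryForm, List.map_cons, List.sum_cons, map_add] at ih ⊢
    rw [ih]
    simp [pderiv_X, Derivation.leibniz]
    ring

lemma pderiv_one_ternaryForm (l : List (ℤ × ℕ × ℕ × ℕ)) : pderiv 1 (ternaryForm l) =
    ternaryForm (l.map fun t => (t.1 * t.2.2.1, t.2.1, t.2.2.1 - 1, t.2.2.2)) := by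
  induction l with
  | nil => simp [ternaryForm]
  | cons t l ih =>
    simp only [ternaryForm, List.map_cons, List.sum_cons, map_add] at ih ⊢
    rw [ih]
    simp [pderiv_X, Derivation.leibniz]
    ring

lemma pderiv_two_ternaryForm (l : List (ℤ × ℕ × ℕ × ℕ)) : pderiv 2 (ternaryForm l) =
    ternaryForm (l.map fun t => (t.1 * t.2.2.2, t.2.1, t.2.2.1, t.2.2.2 - 1)) := by
  induction l with
  | nil => simp [ternaryForm]
  | cons t l ih =>
    simp only [ternaryForm, List.map_cons, List.sum_cons, map_add] at ih ⊢
    rw [ih]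
    simp [pderiv_X, Derivation.leibniz]
    ring

lemma numeral_mul_C {a b : ℕ} {c : ℂ} (h : (a : ℂ) * c = b) : (a : S3) * (C c : S3) = b := by
  rw [← map_natCast (C : ℂ →+* S3), ← C_mul, h, map_natCast]

lemma isUnit_natCast_S3 {n : ℕ} (hn : n ≠ 0) : IsUnit (n : S3) := by
  rw [← map_natCast (C : ℂ →+* S3)]
  exact (IsUnit.mk0 (n : ℂ) (Nat.cast_ne_zero.2 hn)).map C

/-- First generator of the Jacobian syzygies of `z f0'`. -/
def syzLineF0Fst : Fin 3 → S3 :=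
  ![ternaryForm
      [(22680, 3, 2, 0), (-36608, 3, 1, 1), (7128, 2, 1, 2), (-36608, 2, 0, 3), (37260, 1, 1, 3),
      (-43008, 1, 0, 4), (-25344, 0, 0, 5)],
    ternaryForm
      [(-35235, 2, 3, 0), (54912, 2, 2, 1), (-35046, 1, 2, 2), (73216, 1, 1, 3),
      (-60750, 0, 2, 3), (27645, 0, 1, 4), (18304, 0, 0, 5)],
    ternaryForm
      [(4860, 2, 2, 1), (8316, 1, 1, 3), (6075, 0, 1, 4), (3456, 0, 0, 5)]]

/-- Second generator of the Jacobian syzygies of `z f0'`. -/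
def syzLineF0Snd : Fin 3 → S3 :=
  ![ternaryForm
      [(2816, 4, 1, 0), (504, 3, 1, 1), (2816, 3, 0, 2), (2616, 2, 0, 3), (828, 1, 0, 4)],
    ternaryForm
      [(-4224, 3, 2, 0), (-783, 2, 2, 1), (-5632, 2, 1, 2), (-3390, 1, 1, 3), (-1408, 1, 0, 4),
      (-1350, 0, 1, 4), (-495, 0, 0, 5)],
    ternaryForm
      [(108, 2, 1, 2), (108, 1, 0, 4), (135, 0, 0, 5)]]

/-- First generator of the Jacobian syzygies of `z fb'`. -/
def syzLineFbFst : Fin 3 → S3 :=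
  ![ternaryForm
      [(2520, 3, 2, 0), (497664, 3, 1, 1), (-50472, 2, 1, 2), (497664, 2, 0, 3), (4140, 1, 1, 3),
      (244224, 1, 0, 4), (-11264, 0, 0, 5)],
    ternaryForm
      [(-3915, 2, 3, 0), (-756864, 2, 2, 1), (73674, 1, 2, 2), (-1099008, 1, 1, 3),
      (-6750, 0, 2, 3), (-258795, 0, 1, 4), (-342144, 0, 0, 5)],
    ternaryForm
      [(540, 2, 2, 1), (41472, 2, 1, 2), (-1764, 1, 1, 3), (41472, 1, 0, 4), (675, 0, 1, 4),
      (28800, 0, 0, 5)]]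

/-- Second generator of the Jacobian syzygies of `z fb'`. -/
def syzLineFbSnd : Fin 3 → S3 :=
  ![ternaryForm
      [(55296, 4, 1, 0), (1512, 3, 1, 1), (55296, 3, 0, 2), (34536, 2, 0, 3), (2484, 1, 0, 4)],
    ternaryForm
      [(-84096, 3, 2, 0), (-2349, 2, 2, 1), (-122112, 2, 1, 2), (-44730, 1, 1, 3),
      (-38016, 1, 0, 4), (-4050, 0, 1, 4), (-5005, 0, 0, 5)],
    ternaryForm
      [(4608, 3, 1, 1), (324, 2, 1, 2), (4608, 2, 0, 3), (3780, 1, 0, 4), (405, 0, 0, 5)]]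

/-- Generator of degree 5 of the Jacobian syzygies of `z f1'`. -/
def syzLineF1Fst : Fin 3 → S3 :=
  ![ternaryForm
      [(119031660, 4, 1, 0), (45360, 3, 2, 0), (27631052, 3, 1, 1), (119031660, 3, 0, 2),
      (1182114, 2, 1, 2), (57388967, 2, 0, 3), (74520, 1, 1, 3), (13644132, 1, 0, 4),
      (141768, 0, 0, 5)],
    ternaryForm
      [(-178547490, 3, 2, 0), (-70470, 2, 3, 0), (-41950317, 2, 2, 1), (-238063320, 2, 1, 2),
      (-1837188, 1, 2, 2), (-60299494, 1, 1, 3), (-59515830, 1, 0, 4), (-121500, 0, 2, 3),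
      (-16177110, 0, 1, 4), (11408738, 0, 0, 5)],
    ternaryForm
      [(9720, 2, 2, 1), (2014956, 2, 1, 2), (77868, 1, 1, 3), (2014956, 1, 0, 4),
      (12150, 0, 1, 4), (1579365, 0, 0, 5)]]

/-- First generator of degree 6 of the Jacobian syzygies of `z f1'`. -/
def syzLineF1Snd : Fin 3 → S3 :=
  ![ternaryForm
      [(114840, 5, 1, 0), (16948, 4, 1, 1), (114840, 4, 0, 2), (-504, 3, 1, 2), (45658, 3, 0, 3),
      (8643, 2, 0, 4), (-828, 1, 0, 5)],
    ternaryForm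
      [(-172260, 4, 2, 0), (-25908, 3, 2, 1), (-229680, 3, 1, 2), (783, 2, 2, 2),
      (-38756, 2, 1, 3), (-57420, 2, 0, 4), (-11190, 1, 1, 4), (15862, 1, 0, 5), (1350, 0, 1, 5),
      (-990, 0, 0, 6)],
    ternaryForm
      [(1944, 3, 1, 2), (-108, 2, 1, 3), (1944, 2, 0, 4), (1350, 1, 0, 5), (-135, 0, 0, 6)]]

/-- Second generator of degree 6 of the Jacobian syzygies of `z f1'`. -/
def syzLineF1Trd : Fin 3 → S3 :=
  ![ternaryForm
      [(-3960, 4, 2, 0), (172260, 4, 1, 1), (33452, 3, 1, 2), (172260, 3, 0, 3),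
      (-3456, 2, 1, 3), (80477, 2, 0, 4), (17772, 1, 0, 5), (-792, 0, 0, 6)],
    ternaryForm
      [(5940, 3, 3, 0), (-258390, 3, 2, 1), (-48927, 2, 2, 2), (-344520, 2, 1, 3),
      (3672, 1, 2, 3), (-80134, 1, 1, 4), (-86130, 1, 0, 5), (-20310, 0, 1, 5),
      (17798, 0, 0, 6)],
    ternaryForm
      [(2916, 2, 1, 3), (108, 1, 1, 4), (2916, 1, 0, 5), (2295, 0, 0, 6)]]

/-- Coefficient of `∂f0'/∂x` in an expression of `3 z¹⁷`. -/
def powCoeffX : S3 :=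
  ternaryForm
    [(-144, 6, 2, 0), (-288, 5, 1, 2), (-216, 4, 1, 3), (-144, 4, 0, 4), (-88, 3, 0, 5),
    (-45, 2, 0, 6)]

/-- Coefficient of `∂f0'/∂y` in an expression of `3 z¹⁷`. -/
def powCoeffY : S3 :=
  ternaryForm
    [(216, 5, 3, 0), (504, 4, 2, 2), (270, 3, 2, 3), (360, 3, 1, 4), (132, 2, 1, 5),
    (72, 2, 0, 6), (-10, 1, 0, 7), (3, 0, 0, 8)]

/-- Minus the first component of a syzygy of `f0' fb'`. -/
def pencilCoeffX : S3 :=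
  ternaryForm
    [(-729, 5, 3, 2), (117, 4, 2, 4), (-1458, 3, 2, 5), (2421, 3, 1, 6), (948, 2, 1, 7),
    (1575, 2, 0, 8), (-729, 1, 1, 8), (1702, 1, 0, 9), (813, 0, 0, 10)]

/-- Minus the second component of a syzygy of `f0' fb'`. -/
def pencilCoeffY : S3 :=
  ternaryForm
    [(324, 5, 4, 1), (1458, 4, 4, 2), (1296, 4, 3, 3), (2259, 3, 3, 4), (1944, 3, 2, 5),
    (2916, 2, 3, 5), (-243, 2, 2, 6), (1296, 2, 1, 7), (1872, 1, 2, 7), (-1431, 1, 1, 8),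
    (324, 1, 0, 9), (1458, 0, 2, 8), (-468, 0, 1, 9), (-387, 0, 0, 10)]

lemma nine_mul_f0' : 9 * f0' = ternaryForm
    [(9, 6, 4, 0), (36, 5, 3, 2), (27, 4, 3, 3), (54, 4, 2, 4), (65, 3, 2, 5), (36, 3, 1, 6),
    (27, 2, 2, 6), (49, 2, 1, 7), (9, 2, 0, 8), (30, 1, 1, 8), (11, 1, 0, 9), (9, 0, 1, 9),
    (3, 0, 0, 10)] := by
  have h₁ : 9 * (C (65 / 9 : ℂ) : S3) = 65 :=
    mod_cast numeral_mul_C (a := 9) (b := 65) (by norm_num)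
  have h₂ : 9 * (C (49 / 9 : ℂ) : S3) = 49 :=
    mod_cast numeral_mul_C (a := 9) (b := 49) (by norm_num)
  have h₃ : 9 * (C (10 / 3 : ℂ) : S3) = 30 :=
    mod_cast numeral_mul_C (a := 9) (b := 30) (by norm_num)
  have h₄ : 9 * (C (11 / 9 : ℂ) : S3) = 11 :=
    mod_cast numeral_mul_C (a := 9) (b := 11) (by norm_num)
  have h₅ : 9 * (C (1 / 3 : ℂ) : S3) = 3 :=
    mod_cast numeral_mul_C (a := 9) (b := 3) (by norm_num)
  simp only [f0', ternaryForm, List.map_cons, List.map_nil, List.sum_cons, List.sum_nil]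
  push_cast
  linear_combination X 0 ^ 3 * X 1 ^ 2 * X 2 ^ 5 * h₁ + X 0 ^ 2 * X 1 * X 2 ^ 7 * h₂ +
    X 0 * X 1 * X 2 ^ 8 * h₃ + X 0 * X 2 ^ 9 * h₄ + X 2 ^ 10 * h₅

lemma nine_mul_pderiv (i : Fin 3) (f : S3) : 9 * pderiv i f = pderiv i (9 * f) := by
  simpa [ofNat_smul_eq_nsmul] using (map_nsmul (pderiv i) 9 f).symm

lemma nine_mul_pderiv_zero_f0' : 9 * pderiv 0 f0' = ternaryForm
    [(54, 5, 4, 0), (180, 4, 3, 2), (108, 3, 3, 3), (216, 3, 2, 4), (195, 2, 2, 5),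
    (108, 2, 1, 6), (54, 1, 2, 6), (98, 1, 1, 7), (18, 1, 0, 8), (30, 0, 1, 8), (11, 0, 0, 9)] := by
  rw [nine_mul_pderiv, nine_mul_f0', pderiv_zero_ternaryForm]
  simp only [ternaryForm, List.map_cons, List.map_nil, List.sum_cons, List.sum_nil]
  push_cast
  ring

lemma nine_mul_pderiv_one_f0' : 9 * pderiv 1 f0' = ternaryForm
    [(36, 6, 3, 0), (108, 5, 2, 2), (81, 4, 2, 3), (108, 4, 1, 4), (130, 3, 1, 5), (36, 3, 0, 6),
    (54, 2, 1, 6), (49, 2, 0, 7), (30, 1, 0, 8), (9, 0, 0, 9)] := by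
  rw [nine_mul_pderiv, nine_mul_f0', pderiv_one_ternaryForm]
  simp only [ternaryForm, List.map_cons, List.map_nil, List.sum_cons, List.sum_nil]
  push_cast
  ring

lemma nine_mul_pderiv_two_f0' : 9 * pderiv 2 f0' = ternaryForm
    [(72, 5, 3, 1), (81, 4, 3, 2), (216, 4, 2, 3), (325, 3, 2, 4), (216, 3, 1, 5),
    (162, 2, 2, 5), (343, 2, 1, 6), (72, 2, 0, 7), (240, 1, 1, 7), (99, 1, 0, 8), (81, 0, 1, 8),
    (30, 0, 0, 9)] := by
  rw [nine_mul_pderiv, nine_mul_f0', pderiv_two_ternaryForm]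
  simp only [ternaryForm, List.map_cons, List.map_nil, List.sum_cons, List.sum_nil]
  push_cast
  ring

/-! ### The curves -/

lemma isHomogeneous_f0' : f0'.IsHomogeneous 10 := by
  have h : f0' = C (1 / 9 : ℂ) * (9 * f0') := by
    have h9 : 9 * (C (1 / 9 : ℂ) : S3) = 1 :=
      mod_cast numeral_mul_C (a := 9) (b := 1) (by norm_num)
    linear_combination -f0' * h9
  rw [h, nine_mul_f0']
  exact (isHomogeneous_ternaryForm (by decide)).C_mul _

lemma isHomogeneous_fb' : fb'.IsHomogeneous 10 :=
  isHomogeneous_f0'.add (isHomogeneous_C_mul_X_pow _ _ _)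

lemma isHomogeneous_f1' : f1'.IsHomogeneous 10 :=
  isHomogeneous_f0'.sub (isHomogeneous_X_pow _ _)

lemma euler_f0' : X 0 * pderiv 0 f0' + X 1 * pderiv 1 f0' + X 2 * pderiv 2 f0' = 10 * f0' := by
  simpa [Fin.sum_univ_three] using isHomogeneous_f0'.sum_X_mul_pderiv

lemma eightyOne_mul_fb' : 81 * fb' = 81 * f0' + 64 * X 2 ^ 10 := by
  have h : 81 * (C (64 / 81 : ℂ) : S3) = 64 :=
    mod_cast numeral_mul_C (a := 81) (b := 64) (by norm_num)
  rw [fb']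
  linear_combination X 2 ^ 10 * h

lemma pderiv_zero_fb' : pderiv 0 fb' = pderiv 0 f0' := by
  simp [fb', pderiv_X]

lemma pderiv_one_fb' : pderiv 1 fb' = pderiv 1 f0' := by
  simp [fb', pderiv_X]

lemma eightyOne_mul_pderiv_two_fb' :
    81 * pderiv 2 fb' = 81 * pderiv 2 f0' + 640 * X 2 ^ 9 := by
  have h : 81 * (C (64 / 81 : ℂ) : S3) = 64 :=
    mod_cast numeral_mul_C (a := 81) (b := 64) (by norm_num)
  simp only [fb', map_add, Derivation.leibniz, Derivation.leibniz_pow, pderiv_C, pderiv_X_self]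
  simp only [smul_eq_mul, nsmul_eq_mul]
  push_cast
  linear_combination 10 * X 2 ^ 9 * h

lemma pderiv_zero_f1' : pderiv 0 f1' = pderiv 0 f0' := by
  simp [f1', pderiv_X]

lemma pderiv_one_f1' : pderiv 1 f1' = pderiv 1 f0' := by
  simp [f1', pderiv_X]

lemma pderiv_two_f1' : pderiv 2 f1' = pderiv 2 f0' - 10 * X 2 ^ 9 := by
  simp [f1', pderiv_X]

lemma pderiv_zero_X_two_mul (f : S3) : pderiv 0 (X 2 * f) = X 2 * pderiv 0 f := by
  simp [Derivation.leibniz, pderiv_X]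

lemma pderiv_one_X_two_mul (f : S3) : pderiv 1 (X 2 * f) = X 2 * pderiv 1 f := by
  simp [Derivation.leibniz, pderiv_X]

lemma pderiv_two_X_two_mul (f : S3) : pderiv 2 (X 2 * f) = f + X 2 * pderiv 2 f := by
  simp [Derivation.leibniz, pderiv_X]
  ring

/-! ### Primitivity of the gradients -/

lemma eval_f0' : eval ![1, 1, 0] f0' = 1 := by
  simp [f0']

lemma eval_fb' : eval ![1, 1, 0] fb' = 1 := by
  simp [fb', eval_f0']

lemma eval_pderiv_zero_f0' : eval ![1, 1, 0] (pderiv 0 f0') = 6 := by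
  have h := congrArg (eval ![1, 1, 0]) nine_mul_pderiv_zero_f0'
  simp [ternaryForm] at h
  linear_combination (1 / 9 : ℂ) * h

lemma pderiv_zero_f0'_ne_zero : pderiv 0 f0' ≠ 0 := fun h => by
  have := eval_pderiv_zero_f0'
  simp [h] at this

lemma f0'_add_fb'_ne_zero : f0' + fb' ≠ 0 := fun h => by
  have := congrArg (eval ![1, 1, 0]) h
  norm_num [eval_f0', eval_fb'] at this

lemma not_dvd_f0'_of_dvd_X_two {p : S3} (hp : Prime p) (hz : p ∣ X 2) : ¬ p ∣ f0' := by
  intro hf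
  have hX : Irreducible (X 2 : S3) := X_prime.irreducible
  obtain ⟨r, hr⟩ := ((hp.irreducible.associated_of_dvd hX hz).dvd_iff_dvd_left).1 hf
  have := congrArg (eval ![1, 1, 0]) hr
  simp [eval_f0'] at this

lemma dvd_of_dvd_natCast_mul {p a : S3} (hp : Prime p) {n : ℕ} (hn : n ≠ 0)
    (h : p ∣ (n : S3) * a) : p ∣ a :=
  (hp.dvd_or_dvd h).resolve_left fun hu =>
    hp.not_isUnit (isUnit_of_dvd_unit hu (isUnit_natCast_S3 hn))

lemma powCoeff_combination :
    powCoeffX * pderiv 0 f0' + powCoeffY * pderiv 1 f0' = 3 * X 2 ^ 17 := by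
  have h0 := nine_mul_pderiv_zero_f0'
  have h1 := nine_mul_pderiv_one_f0'
  have h9 : (9 : S3) ≠ 0 := by norm_num
  apply mul_left_cancel₀ h9
  simp only [powCoeffX, powCoeffY, ternaryForm, List.map_cons, List.map_nil, List.sum_cons,
    List.sum_nil] at h0 h1 ⊢
  push_cast at h0 h1 ⊢
  rw [mul_add, mul_left_comm, mul_left_comm 9 _ (pderiv 1 f0'), h0, h1]
  ring

lemma not_dvd_pderiv_one_f0' {p : S3} (hp : Prime p) (h0 : p ∣ pderiv 0 f0') :
    ¬ p ∣ pderiv 1 f0' := by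
  intro h1
  have hz : p ∣ X 2 := by
    refine hp.dvd_of_dvd_pow (dvd_of_dvd_natCast_mul hp three_ne_zero (a := X 2 ^ 17) ?_)
    exact_mod_cast powCoeff_combination ▸ (h0.mul_left _).add (h1.mul_left _)
  refine not_dvd_f0'_of_dvd_X_two hp hz (dvd_of_dvd_natCast_mul hp (n := 10) (by norm_num) ?_)
  exact_mod_cast euler_f0' ▸ ((h0.mul_left _).add (h1.mul_left _)).add (hz.mul_right _)

lemma hasPrimitiveGradient_X_two_mul {f : S3} (h0 : pderiv 0 f = pderiv 0 f0')
    (h1 : pderiv 1 f = pderiv 1 f0') (hf : X 2 ∣ f - f0') :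
    HasPrimitiveGradient (X 2 * f) where
  ne_zero := by
    rw [pderiv_zero_X_two_mul, h0]
    exact mul_ne_zero (X_ne_zero 2) pderiv_zero_f0'_ne_zero
  not_dvd p hp d0 d1 d2 := by
    rw [pderiv_zero_X_two_mul, h0] at d0
    rw [pderiv_one_X_two_mul, h1] at d1
    rw [pderiv_two_X_two_mul] at d2
    have hz : p ∣ X 2 := by
      by_contra hz
      exact not_dvd_pderiv_one_f0' hp ((hp.dvd_or_dvd d0).resolve_left hz)
        ((hp.dvd_or_dvd d1).resolve_left hz)
    refine not_dvd_f0'_of_dvd_X_two hp hz ?_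
    have := (dvd_sub d2 (hz.mul_right (pderiv 2 f))).sub (hz.trans hf)
    simpa using this

lemma not_dvd_X_two_of_dvd_add {p : S3} (hp : Prime p) (h : p ∣ f0' + fb') : ¬ p ∣ X 2 := by
  intro hz
  refine not_dvd_f0'_of_dvd_X_two hp hz (dvd_of_dvd_natCast_mul hp (n := 162) (by norm_num) ?_)
  have := (h.mul_left 81).sub (hz.mul_left (64 * X 2 ^ 9))
  convert this using 1
  push_cast
  linear_combination -eightyOne_mul_fb'

lemma not_dvd_f0'_of_dvd_add {p : S3} (hp : Prime p) (h : p ∣ f0' + fb') : ¬ p ∣ f0' := by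
  intro hf
  refine not_dvd_X_two_of_dvd_add hp h (hp.dvd_of_dvd_pow (n := 10)
    (dvd_of_dvd_natCast_mul hp (n := 64) (by norm_num) ?_))
  have := (h.mul_left 81).sub (hf.mul_left 162)
  convert this using 1
  push_cast
  linear_combination -eightyOne_mul_fb'

lemma pderiv_zero_f0'_mul_fb' : pderiv 0 (f0' * fb') = pderiv 0 f0' * (f0' + fb') := by
  simp only [Derivation.leibniz, smul_eq_mul, pderiv_zero_fb']
  ring

lemma pderiv_one_f0'_mul_fb' : pderiv 1 (f0' * fb') = pderiv 1 f0' * (f0' + fb') := by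
  simp only [Derivation.leibniz, smul_eq_mul, pderiv_one_fb']
  ring

lemma eightyOne_mul_pderiv_two_f0'_mul_fb' : 81 * pderiv 2 (f0' * fb') =
    81 * pderiv 2 f0' * (f0' + fb') + 640 * X 2 ^ 9 * f0' := by
  simp only [Derivation.leibniz, smul_eq_mul]
  linear_combination f0' * eightyOne_mul_pderiv_two_fb'

lemma hasPrimitiveGradient_f0'_mul_fb' : HasPrimitiveGradient (f0' * fb') where
  ne_zero := by
    rw [pderiv_zero_f0'_mul_fb']
    exact mul_ne_zero pderiv_zero_f0'_ne_zero f0'_add_fb'_ne_zero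
  not_dvd p hp d0 d1 d2 := by
    rw [pderiv_zero_f0'_mul_fb'] at d0
    rw [pderiv_one_f0'_mul_fb'] at d1
    have hs : p ∣ f0' + fb' := by
      by_contra hs
      exact not_dvd_pderiv_one_f0' hp ((hp.dvd_or_dvd d0).resolve_right hs)
        ((hp.dvd_or_dvd d1).resolve_right hs)
    have h : p ∣ ((640 : ℕ) : S3) * (X 2 ^ 9 * f0') := by
      convert (d2.mul_left 81).sub (hs.mul_left (81 * pderiv 2 f0')) using 1
      push_cast
      linear_combination -eightyOne_mul_pderiv_two_f0'_mul_fb'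
    rcases hp.dvd_or_dvd (dvd_of_dvd_natCast_mul hp (by norm_num) h) with hz | hf
    · exact not_dvd_X_two_of_dvd_add hp hs (hp.dvd_of_dvd_pow hz)
    · exact not_dvd_f0'_of_dvd_add hp hs hf

lemma hasPrimitiveGradient_X_two_mul_f0'_mul_fb' :
    HasPrimitiveGradient (X 2 * (f0' * fb')) where
  ne_zero := by
    rw [pderiv_zero_X_two_mul]
    exact mul_ne_zero (X_ne_zero 2) hasPrimitiveGradient_f0'_mul_fb'.ne_zero
  not_dvd p hp d0 d1 d2 := by
    rw [pderiv_zero_X_two_mul, pderiv_zero_f0'_mul_fb'] at d0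
    rw [pderiv_one_X_two_mul, pderiv_one_f0'_mul_fb'] at d1
    rw [pderiv_two_X_two_mul] at d2
    by_cases hz : p ∣ X 2
    · have hprod : p ∣ f0' * fb' := by
        simpa using d2.sub (hz.mul_right (pderiv 2 (f0' * fb')))
      refine not_dvd_f0'_of_dvd_X_two hp hz ((hp.dvd_or_dvd hprod).elim id fun hb => ?_)
      rw [fb'] at hb
      exact (dvd_add_left ((dvd_pow hz (by norm_num)).mul_left _)).1 hb
    · have hs : p ∣ f0' + fb' := by
        by_contra hs
        exact not_dvd_pderiv_one_f0' hp
          ((hp.dvd_or_dvd ((hp.dvd_or_dvd d0).resolve_left hz)).resolve_right hs)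
          ((hp.dvd_or_dvd ((hp.dvd_or_dvd d1).resolve_left hz)).resolve_right hs)
      have h : p ∣ ((1344 : ℕ) : S3) * (X 2 ^ 10 * f0') := by
        convert (d2.mul_left 162).sub
          (hs.mul_left (81 * f0' + 162 * X 2 * pderiv 2 f0')) using 1
        push_cast
        linear_combination -f0' * eightyOne_mul_fb' -
          2 * X 2 * eightyOne_mul_pderiv_two_f0'_mul_fb'
      rcases hp.dvd_or_dvd (dvd_of_dvd_natCast_mul hp (by norm_num) h) with hz' | hf
      · exact hz (hp.dvd_of_dvd_pow hz')
      · exact not_dvd_f0'_of_dvd_add hp hs hf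

/-! ### Free resolutions for the curves with the line at infinity -/

lemma crossEq_syzLineF0 : CrossEq (X 2 * f0') ((3421440 : ℕ) : S3) syzLineF0Fst syzLineF0Snd := by
  have h := nine_mul_f0'
  have h0 := nine_mul_pderiv_zero_f0'
  have h1 := nine_mul_pderiv_one_f0'
  have h2 := nine_mul_pderiv_two_f0'
  simp only [ternaryForm, List.map_cons, List.map_nil, List.sum_cons, List.sum_nil] at h h0 h1 h2
  push_cast at h h0 h1 h2
  constructor <;>
    simp only [pderiv_zero_X_two_mul, pderiv_one_X_two_mul, pderiv_two_X_two_mul, syzLineF0Fst,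
      syzLineF0Snd, Matrix.cons_val, ternaryForm, List.map_cons, List.map_nil, List.sum_cons,
      List.sum_nil] <;>
    push_cast
  · linear_combination -380160 * X 2 * h0
  · linear_combination -380160 * X 2 * h1
  · linear_combination -380160 * h - 380160 * X 2 * h2

lemma crossEq_syzLineFb : CrossEq (X 2 * fb') ((4561920 : ℕ) : S3) syzLineFbFst syzLineFbSnd := by
  have h := nine_mul_f0'
  have h0 := nine_mul_pderiv_zero_f0'
  have h1 := nine_mul_pderiv_one_f0'
  have h2 := nine_mul_pderiv_two_f0'
  simp only [ternaryForm, List.map_cons, List.map_nil, List.sum_cons, List.sum_nil] at h h0 h1 h2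
  push_cast at h h0 h1 h2
  constructor <;>
    simp only [pderiv_zero_X_two_mul, pderiv_one_X_two_mul, pderiv_two_X_two_mul, pderiv_zero_fb',
      pderiv_one_fb', syzLineFbFst, syzLineFbSnd, Matrix.cons_val, ternaryForm, List.map_cons,
      List.map_nil, List.sum_cons, List.sum_nil] <;>
    push_cast
  · linear_combination -506880 * X 2 * h0
  · linear_combination -506880 * X 2 * h1
  · linear_combination -56320 * eightyOne_mul_fb' -
      56320 * X 2 * eightyOne_mul_pderiv_two_fb' - 506880 * h - 506880 * X 2 * h2

/-- Cofactor of the gradient of `z f1'` in the product of its second and third syzygies. -/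
def coeffLineF1Fst : S3 := ternaryForm [(-1924560, 1, 0, 1), (106920, 0, 0, 2)]

/-- Cofactor of the gradient of `z f1'` in the product of its third and first syzygies. -/
def coeffLineF1Snd : S3 := ternaryForm [(9622800, 0, 1, 0), (1576214640, 0, 0, 1)]

/-- Cofactor of the gradient of `z f1'` in the product of its first and second syzygies. -/
def coeffLineF1Trd : S3 := ternaryForm [(279061200, 1, 0, 0), (19138680, 0, 0, 1)]

lemma coeffLineF1Fst_ne_zero : coeffLineF1Fst ≠ 0 := fun h => by
  have := congrArg (eval ![0, 0, 1]) h
  simp [coeffLineF1Fst, ternaryForm] at this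

lemma not_isUnit_coeffLineF1Fst : ¬ IsUnit coeffLineF1Fst := fun h =>
  (h.map (eval 0)).ne_zero (by simp [coeffLineF1Fst, ternaryForm])

lemma coeffLineF1Snd_ne_zero : coeffLineF1Snd ≠ 0 := fun h => by
  have := congrArg (eval ![0, 0, 1]) h
  simp [coeffLineF1Snd, ternaryForm] at this

lemma not_isUnit_coeffLineF1Snd : ¬ IsUnit coeffLineF1Snd := fun h =>
  (h.map (eval 0)).ne_zero (by simp [coeffLineF1Snd, ternaryForm])

lemma coeffLineF1Trd_ne_zero : coeffLineF1Trd ≠ 0 := fun h => by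
  have := congrArg (eval ![0, 0, 1]) h
  simp [coeffLineF1Trd, ternaryForm] at this

lemma not_isUnit_coeffLineF1Trd : ¬ IsUnit coeffLineF1Trd := fun h =>
  (h.map (eval 0)).ne_zero (by simp [coeffLineF1Trd, ternaryForm])

lemma crossEq_syzLineF1_snd_trd :
    CrossEq (X 2 * f1') coeffLineF1Fst syzLineF1Snd syzLineF1Trd := by
  have h := nine_mul_f0'
  have h0 := nine_mul_pderiv_zero_f0'
  have h1 := nine_mul_pderiv_one_f0'
  have h2 := nine_mul_pderiv_two_f0'
  simp only [ternaryForm, List.map_cons, List.map_nil, List.sum_cons, List.sum_nil] at h h0 h1 h2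
  push_cast at h h0 h1 h2
  constructor <;>
    simp only [pderiv_zero_X_two_mul, pderiv_one_X_two_mul, pderiv_two_X_two_mul, pderiv_zero_f1',
      pderiv_one_f1', pderiv_two_f1', syzLineF1Snd, syzLineF1Trd, coeffLineF1Fst,
      Matrix.cons_val, ternaryForm, List.map_cons, List.map_nil, List.sum_cons, List.sum_nil] <;>
    push_cast
  · linear_combination -(-213840 * X 0 * X 2 + 11880 * X 2 ^ 2) * X 2 * h0
  · linear_combination -(-213840 * X 0 * X 2 + 11880 * X 2 ^ 2) * X 2 * h1
  · rw [f1']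
    linear_combination -(-213840 * X 0 * X 2 + 11880 * X 2 ^ 2) * (h + X 2 * h2)

lemma crossEq_syzLineF1_trd_fst :
    CrossEq (X 2 * f1') coeffLineF1Snd syzLineF1Trd syzLineF1Fst := by
  have h := nine_mul_f0'
  have h0 := nine_mul_pderiv_zero_f0'
  have h1 := nine_mul_pderiv_one_f0'
  have h2 := nine_mul_pderiv_two_f0'
  simp only [ternaryForm, List.map_cons, List.map_nil, List.sum_cons, List.sum_nil] at h h0 h1 h2
  push_cast at h h0 h1 h2
  constructor <;>
    simp only [pderiv_zero_X_two_mul, pderiv_one_X_two_mul, pderiv_two_X_two_mul, pderiv_zero_f1',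
      pderiv_one_f1', pderiv_two_f1', syzLineF1Fst, syzLineF1Trd, coeffLineF1Snd,
      Matrix.cons_val, ternaryForm, List.map_cons, List.map_nil, List.sum_cons, List.sum_nil] <;>
    push_cast
  · linear_combination -(1069200 * X 1 + 175134960 * X 2) * X 2 * h0
  · linear_combination -(1069200 * X 1 + 175134960 * X 2) * X 2 * h1
  · rw [f1']
    linear_combination -(1069200 * X 1 + 175134960 * X 2) * (h + X 2 * h2)

lemma crossEq_syzLineF1_fst_snd :
    CrossEq (X 2 * f1') coeffLineF1Trd syzLineF1Fst syzLineF1Snd := by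
  have h := nine_mul_f0'
  have h0 := nine_mul_pderiv_zero_f0'
  have h1 := nine_mul_pderiv_one_f0'
  have h2 := nine_mul_pderiv_two_f0'
  simp only [ternaryForm, List.map_cons, List.map_nil, List.sum_cons, List.sum_nil] at h h0 h1 h2
  push_cast at h h0 h1 h2
  constructor <;>
    simp only [pderiv_zero_X_two_mul, pderiv_one_X_two_mul, pderiv_two_X_two_mul, pderiv_zero_f1',
      pderiv_one_f1', pderiv_two_f1', syzLineF1Fst, syzLineF1Snd, coeffLineF1Trd,
      Matrix.cons_val, ternaryForm, List.map_cons, List.map_nil, List.sum_cons, List.sum_nil] <;>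
    push_cast
  · linear_combination -(31006800 * X 0 + 2126520 * X 2) * X 2 * h0
  · linear_combination -(31006800 * X 0 + 2126520 * X 2) * X 2 * h1
  · rw [f1']
    linear_combination -(31006800 * X 0 + 2126520 * X 2) * (h + X 2 * h2)

/-- Modulo an ideal containing all `X i - s i`, every polynomial is congruent to its value
at `s`. -/
lemma sub_aeval_mem {σ R : Type*} [CommRing R] {I : Ideal (MvPolynomial σ R)}
    {s : σ → MvPolynomial σ R} (hs : ∀ i, X i - s i ∈ I) (p : MvPolynomial σ R) :
    p - aeval s p ∈ I := by
  rw [← Ideal.Quotient.eq]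
  have h : (Ideal.Quotient.mkₐ R I) = (Ideal.Quotient.mkₐ R I).comp (aeval s) := by
    ext i
    simpa using Ideal.Quotient.eq.2 (hs i)
  exact DFunLike.congr_fun h p

lemma aeval_ternaryForm (s : Fin 3 → S3) (l : List (ℤ × ℕ × ℕ × ℕ)) :
    aeval s (ternaryForm l) =
      (l.map fun t => (t.1 : S3) * s 0 ^ t.2.1 * s 1 ^ t.2.2.1 * s 2 ^ t.2.2.2).sum := by
  simp only [ternaryForm, map_list_sum, List.map_map, Function.comp_def, map_mul, map_pow,
    map_intCast, aeval_X]

lemma exists_eq_mul_of_mul_coeffLineF1Trd_eq {a b : S3}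
    (h : a * coeffLineF1Trd = b * coeffLineF1Snd) :
    ∃ t, a = t * coeffLineF1Snd ∧ b = t * coeffLineF1Trd := by
  have hC : 9622800 * (C (1 / 9622800 : ℂ) : S3) = 1 :=
    mod_cast numeral_mul_C (a := 9622800) (b := 1) (by norm_num)
  have hC' : 5 * (C (819 / 5 : ℂ) : S3) = 819 :=
    mod_cast numeral_mul_C (a := 5) (b := 819) (by norm_num)
  have hmem : a - aeval ![X 0, -C (819 / 5 : ℂ) * X 2, X 2] a ∈ Ideal.span {coeffLineF1Snd} := by
    refine sub_aeval_mem (fun i => ?_) a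
    fin_cases i
    · simp
    · refine Ideal.mem_span_singleton'.2 ⟨C (1 / 9622800 : ℂ), ?_⟩
      simp [-one_div, coeffLineF1Snd, ternaryForm]
      linear_combination (X 1 + C (819 / 5 : ℂ) * X 2) * hC -
        1924560 * C (1 / 9622800 : ℂ) * X 2 * hC'
    · simp
  have hsnd : aeval ![X 0, -C (819 / 5 : ℂ) * X 2, X 2] coeffLineF1Snd = (0 : S3) := by
    rw [coeffLineF1Snd, aeval_ternaryForm]
    simp
    linear_combination -1924560 * X 2 * hC'
  have htrd : aeval ![X 0, -C (819 / 5 : ℂ) * X 2, X 2] coeffLineF1Trd ≠ (0 : S3) := fun h0 => by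
    rw [coeffLineF1Trd, aeval_ternaryForm] at h0
    have := congrArg (eval ![0, 0, 1]) h0
    simp at this
  have heval : aeval ![X 0, -C (819 / 5 : ℂ) * X 2, X 2] a = (0 : S3) := by
    have := congrArg (aeval ![X 0, -C (819 / 5 : ℂ) * X 2, (X 2 : S3)]) h
    rw [map_mul, map_mul, hsnd, mul_zero] at this
    exact (mul_eq_zero.1 this).resolve_right htrd
  rw [heval, sub_zero] at hmem
  obtain ⟨t, rfl⟩ := Ideal.mem_span_singleton'.1 hmem
  exact ⟨t, rfl, mul_right_cancel₀ coeffLineF1Snd_ne_zero (by linear_combination -h)⟩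

lemma exists_eq_add_of_mul_coeffLineF1Fst_eq {a b c : S3}
    (h : a * coeffLineF1Fst = b * coeffLineF1Snd + c * coeffLineF1Trd) :
    ∃ s t, a = s * coeffLineF1Snd + t * coeffLineF1Trd := by
  have hC : 9622800 * (C (1 / 9622800 : ℂ) : S3) = 1 :=
    mod_cast numeral_mul_C (a := 9622800) (b := 1) (by norm_num)
  have hC' : 5 * (C (819 / 5 : ℂ) : S3) = 819 :=
    mod_cast numeral_mul_C (a := 5) (b := 819) (by norm_num)
  have hD : 279061200 * (C (1 / 279061200 : ℂ) : S3) = 1 :=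
    mod_cast numeral_mul_C (a := 279061200) (b := 1) (by norm_num)
  have hD' : 2610 * (C (179 / 2610 : ℂ) : S3) = 179 :=
    mod_cast numeral_mul_C (a := 2610) (b := 179) (by norm_num)
  let s : Fin 3 → S3 := ![-C (179 / 2610 : ℂ) * X 2, -C (819 / 5 : ℂ) * X 2, X 2]
  have hmem : a - aeval s a ∈ Ideal.span {coeffLineF1Snd, coeffLineF1Trd} := by
    refine sub_aeval_mem (fun i => ?_) a
    fin_cases i
    · refine Ideal.mem_span_pair.2 ⟨0, C (1 / 279061200 : ℂ), ?_⟩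
      simp [-one_div, coeffLineF1Trd, ternaryForm, s]
      linear_combination (X 0 + C (179 / 2610 : ℂ) * X 2) * hD -
        106920 * C (1 / 279061200 : ℂ) * X 2 * hD'
    · refine Ideal.mem_span_pair.2 ⟨C (1 / 9622800 : ℂ), 0, ?_⟩
      simp [-one_div, coeffLineF1Snd, ternaryForm, s]
      linear_combination (X 1 + C (819 / 5 : ℂ) * X 2) * hC -
        1924560 * C (1 / 9622800 : ℂ) * X 2 * hC'
    · simp [s]
  have hsnd : aeval s coeffLineF1Snd = 0 := by
    rw [coeffLineF1Snd, aeval_ternaryForm]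
    simp [s]
    linear_combination -1924560 * X 2 * hC'
  have htrd : aeval s coeffLineF1Trd = 0 := by
    rw [coeffLineF1Trd, aeval_ternaryForm]
    simp [s]
    linear_combination -106920 * X 2 * hD'
  have hfst : aeval s coeffLineF1Fst ≠ 0 := fun h0 => by
    rw [coeffLineF1Fst, aeval_ternaryForm] at h0
    have := congrArg (eval ![0, 0, 1]) h0
    simp [s] at this
    norm_num at this
  have heval : aeval s a = 0 := by
    have := congrArg (aeval s) h
    rw [map_mul, map_add, map_mul, map_mul, hsnd, htrd, mul_zero, mul_zero, add_zero] at this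
    exact (mul_eq_zero.1 this).resolve_right hfst
  rw [heval, sub_zero] at hmem
  obtain ⟨r, t, hrt⟩ := Ideal.mem_span_pair.1 hmem
  exact ⟨r, t, hrt.symm⟩

/-! ### Syzygies of the products -/

lemma pencilCoeff_combination : pencilCoeffX * pderiv 0 f0' + pencilCoeffY * pderiv 1 f0' =
    81 * pderiv 2 (f0' * fb') := by
  have h := nine_mul_f0'
  have h0 := nine_mul_pderiv_zero_f0'
  have h1 := nine_mul_pderiv_one_f0'
  have h2 := nine_mul_pderiv_two_f0'
  have key : pencilCoeffX * (9 * pderiv 0 f0') + pencilCoeffY * (9 * pderiv 1 f0') =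
      9 * pderiv 2 f0' * (18 * (9 * f0') + 64 * X 2 ^ 10) + 640 * X 2 ^ 9 * (9 * f0') := by
    rw [h, h0, h1, h2]
    simp only [pencilCoeffX, pencilCoeffY, ternaryForm, List.map_cons, List.map_nil,
      List.sum_cons, List.sum_nil]
    push_cast
    ring
  have h9 : (9 : S3) ≠ 0 := by norm_num
  apply mul_left_cancel₀ h9
  linear_combination -9 * pderiv 2 f0' * eightyOne_mul_fb' -
    9 * eightyOne_mul_pderiv_two_f0'_mul_fb' + key

/-- The Hamiltonian syzygy of `f0'`, common to all members of the pencil. -/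
def syzHamiltonian : Fin 3 → S3 := ![pderiv 1 f0', -pderiv 0 f0', 0]

lemma isHomogeneous_syzHamiltonian (i : Fin 3) : (syzHamiltonian i).IsHomogeneous 9 := by
  have h (j : Fin 3) : (pderiv j f0').IsHomogeneous 9 := isHomogeneous_f0'.pderiv
  fin_cases i
  exacts [h 1, (h 0).neg, isHomogeneous_zero _ _ _]

/-- The syzygy of degree 10 of `f0' fb'`. -/
def syzPencil : Fin 3 → S3 := ![-pencilCoeffX, -pencilCoeffY, 81 * (f0' + fb')]

lemma crossEq_syzPencil : CrossEq (f0' * fb') (-((81 : ℕ) : S3)) syzHamiltonian syzPencil := by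
  constructor <;>
    simp only [syzHamiltonian, syzPencil, Matrix.cons_val, pderiv_zero_f0'_mul_fb',
      pderiv_one_f0'_mul_fb'] <;>
    push_cast
  · ring
  · ring
  · linear_combination -pencilCoeff_combination

/-- The syzygy of degree 11 of `z f0' fb'`. -/
def syzLinePencil : Fin 3 → S3 := fun i => 21 * X 2 * syzPencil i - 81 * (f0' + fb') * X i

lemma crossEq_syzLinePencil :
    CrossEq (X 2 * (f0' * fb')) (-((1620 : ℕ) : S3)) syzHamiltonian syzLinePencil := by
  constructor <;>
    simp only [syzHamiltonian, syzLinePencil, syzPencil, Matrix.cons_val, pderiv_zero_X_two_mul,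
      pderiv_one_X_two_mul, pderiv_two_X_two_mul, pderiv_zero_f0'_mul_fb',
      pderiv_one_f0'_mul_fb'] <;>
    push_cast
  · ring
  · ring
  · linear_combination -21 * X 2 * pencilCoeff_combination - 81 * (f0' + fb') * euler_f0' +
      10 * f0' * eightyOne_mul_fb' - X 2 * eightyOne_mul_pderiv_two_f0'_mul_fb'

lemma isHomogeneous_eightyOne_mul : (81 * (f0' + fb')).IsHomogeneous 10 := by
  have h := (isHomogeneous_f0'.add isHomogeneous_fb').C_mul 81
  rwa [map_ofNat] at h

lemma isHomogeneous_syzPencil (i : Fin 3) : (syzPencil i).IsHomogeneous 10 := by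
  fin_cases i
  exacts [(isHomogeneous_ternaryForm (by decide)).neg, (isHomogeneous_ternaryForm (by decide)).neg,
    isHomogeneous_eightyOne_mul]

lemma isHomogeneous_syzLinePencil (i : Fin 3) : (syzLinePencil i).IsHomogeneous 11 := by
  have h : (21 * X 2 * syzPencil i).IsHomogeneous 11 := by
    have h := ((isHomogeneous_X ℂ (2 : Fin 3)).mul (isHomogeneous_syzPencil i)).C_mul 21
    rwa [map_ofNat, ← mul_assoc] at h
  exact h.sub (isHomogeneous_eightyOne_mul.mul (isHomogeneous_X ℂ i))

/-! ### Minimal generators of the syzygy modules -/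

lemma isMinGenSyz_syzLineF0 :
    IsMinGenSyz (X 2 * f0') 2 ![5, 5] ![syzLineF0Fst, syzLineF0Snd] :=
  (hasPrimitiveGradient_X_two_mul rfl rfl (by simp)).isMinGenSyz_pair
    (isUnit_natCast_S3 (by norm_num)) le_rfl crossEq_syzLineF0
    (fun i => by fin_cases i <;> exact isHomogeneous_ternaryForm (by decide))
    (fun i => by fin_cases i <;> exact isHomogeneous_ternaryForm (by decide))

lemma hasPrimitiveGradient_X_two_mul_fb' : HasPrimitiveGradient (X 2 * fb') :=
  hasPrimitiveGradient_X_two_mul pderiv_zero_fb' pderiv_one_fb'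
    ⟨C (64 / 81) * X 2 ^ 9, by rw [fb']; ring⟩

lemma isMinGenSyz_syzLineFb :
    IsMinGenSyz (X 2 * fb') 2 ![5, 5] ![syzLineFbFst, syzLineFbSnd] :=
  hasPrimitiveGradient_X_two_mul_fb'.isMinGenSyz_pair
    (isUnit_natCast_S3 (by norm_num)) le_rfl crossEq_syzLineFb
    (fun i => by fin_cases i <;> exact isHomogeneous_ternaryForm (by decide))
    (fun i => by fin_cases i <;> exact isHomogeneous_ternaryForm (by decide))

lemma hasPrimitiveGradient_X_two_mul_f1' : HasPrimitiveGradient (X 2 * f1') :=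
  hasPrimitiveGradient_X_two_mul pderiv_zero_f1' pderiv_one_f1'
    ⟨-X 2 ^ 9, by rw [f1']; ring⟩

lemma isMinGenSyz_syzLineF1 :
    IsMinGenSyz (X 2 * f1') 3 ![5, 6, 6] ![syzLineF1Fst, syzLineF1Snd, syzLineF1Trd] :=
  hasPrimitiveGradient_X_two_mul_f1'.isMinGenSyz_triple coeffLineF1Snd_ne_zero
    coeffLineF1Trd_ne_zero coeffLineF1Fst_ne_zero
    (fun _ _ => exists_eq_mul_of_mul_coeffLineF1Trd_eq)
    (fun _ _ _ => exists_eq_add_of_mul_coeffLineF1Fst_eq)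
    not_isUnit_coeffLineF1Fst not_isUnit_coeffLineF1Snd not_isUnit_coeffLineF1Trd (by norm_num)
    crossEq_syzLineF1_snd_trd crossEq_syzLineF1_trd_fst crossEq_syzLineF1_fst_snd
    (fun i => by fin_cases i <;> exact isHomogeneous_ternaryForm (by decide))
    (fun i => by fin_cases i <;> exact isHomogeneous_ternaryForm (by decide))
    (fun i => by fin_cases i <;> exact isHomogeneous_ternaryForm (by decide))

lemma isMinGenSyz_syzPencil :
    IsMinGenSyz (f0' * fb') 2 ![9, 10] ![syzHamiltonian, syzPencil] :=
  hasPrimitiveGradient_f0'_mul_fb'.isMinGenSyz_pair (isUnit_natCast_S3 (by norm_num)).neg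
    (by norm_num) crossEq_syzPencil isHomogeneous_syzHamiltonian isHomogeneous_syzPencil

lemma isMinGenSyz_syzLinePencil :
    IsMinGenSyz (X 2 * (f0' * fb')) 2 ![9, 11] ![syzHamiltonian, syzLinePencil] :=
  hasPrimitiveGradient_X_two_mul_f0'_mul_fb'.isMinGenSyz_pair
    (isUnit_natCast_S3 (by norm_num)).neg (by norm_num) crossEq_syzLinePencil
    isHomogeneous_syzHamiltonian isHomogeneous_syzLinePencil

/-! ### Total Tjurina numbers -/

lemma isTjurina_X_two_mul_fb' : IsTjurina (X 2 * fb') 75 :=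
  isMinGenSyz_syzLineFb.isTjurina_pair (d₁ := 5) (d₂ := 5)
    ((isHomogeneous_X ℂ 2).mul isHomogeneous_fb')
    (crossEq_syzLineFb.linearIndependent hasPrimitiveGradient_X_two_mul_fb'.ne_zero
      (isUnit_natCast_S3 (by norm_num)).ne_zero) (by norm_num)

lemma isTjurina_X_two_mul_f1' : IsTjurina (X 2 * f1') 74 :=
  isMinGenSyz_syzLineF1.isTjurina_triple (d₁ := 5) (s := 0)
    ((isHomogeneous_X ℂ 2).mul isHomogeneous_f1')
    (isHomogeneous_ternaryForm (by decide) : coeffLineF1Fst.IsHomogeneous 2)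
    (isHomogeneous_ternaryForm (by decide) : coeffLineF1Snd.IsHomogeneous 1)
    (isHomogeneous_ternaryForm (by decide) : coeffLineF1Trd.IsHomogeneous 1)
    coeffLineF1Trd_ne_zero
    (CrossEq.relation hasPrimitiveGradient_X_two_mul_f1'.ne_zero coeffLineF1Trd_ne_zero
      crossEq_syzLineF1_snd_trd crossEq_syzLineF1_trd_fst crossEq_syzLineF1_fst_snd)
    (fun _ _ _ => CrossEq.exists_relation hasPrimitiveGradient_X_two_mul_f1'.ne_zero
      coeffLineF1Trd_ne_zero (fun _ _ => exists_eq_mul_of_mul_coeffLineF1Trd_eq)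
      crossEq_syzLineF1_snd_trd crossEq_syzLineF1_trd_fst crossEq_syzLineF1_fst_snd)
    (by norm_num)

lemma isTjurina_f0'_mul_fb' : IsTjurina (f0' * fb') 271 :=
  isMinGenSyz_syzPencil.isTjurina_pair (d₁ := 9) (d₂ := 10)
    (isHomogeneous_f0'.mul isHomogeneous_fb')
    (crossEq_syzPencil.linearIndependent hasPrimitiveGradient_f0'_mul_fb'.ne_zero
      (isUnit_natCast_S3 (by norm_num)).neg.ne_zero) (by norm_num)

lemma isTjurina_X_two_mul_f0'_mul_fb' : IsTjurina (X 2 * (f0' * fb')) 301 :=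
  isMinGenSyz_syzLinePencil.isTjurina_pair (d₁ := 9) (d₂ := 11)
    ((isHomogeneous_X ℂ 2).mul (isHomogeneous_f0'.mul isHomogeneous_fb'))
    (crossEq_syzLinePencil.linearIndependent hasPrimitiveGradient_X_two_mul_f0'_mul_fb'.ne_zero
      (isUnit_natCast_S3 (by norm_num)).neg.ne_zero) (by norm_num)

/-- Freeness properties of the arrangements obtained from the curves `C'₀, C'_{b'}, C'₁` and
the line at infinity `L_z : z = 0`: (1) `C'₀ ∪ L_z` and `C'_{b'} ∪ L_z` are free with
exponents `(5,5)`, with `τ(C'_{b'} ∪ L_z) = 75`; (2) `C'₁ ∪ L_z` is nearly free with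
exponents `(5,6)` and `τ = 74`; (3) `C'₀ ∪ C'_{b'}` is free with exponents `(9,10)` and
`τ = 271`, and `C'₀ ∪ C'_{b'} ∪ L_z` is free with exponents `(9,11)` and `τ = 301`. -/
theorem statement10 :
    (IsFreeWith (X 2 * f0') 5 5 ∧ IsFreeWith (X 2 * fb') 5 5 ∧
      IsTjurina (X 2 * fb') 75) ∧
    (IsNearlyFreeWith (X 2 * f1') 11 5 6 ∧ IsTjurina (X 2 * f1') 74) ∧
    (IsFreeWith (f0' * fb') 9 10 ∧ IsTjurina (f0' * fb') 271) ∧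
    (IsFreeWith (X 2 * (f0' * fb')) 9 11 ∧ IsTjurina (X 2 * (f0' * fb')) 301) := by
  exact ⟨⟨⟨_, isMinGenSyz_syzLineF0⟩, ⟨_, isMinGenSyz_syzLineFb⟩, isTjurina_X_two_mul_fb'⟩,
    ⟨⟨rfl, _, isMinGenSyz_syzLineF1⟩, isTjurina_X_two_mul_f1'⟩,
    ⟨⟨_, isMinGenSyz_syzPencil⟩, isTjurina_f0'_mul_fb'⟩,
    ⟨⟨_, isMinGenSyz_syzLinePencil⟩, isTjurina_X_two_mul_f0'_mul_fb'⟩⟩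

end
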